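/- arXiv:1812.03602 — 12 statements merged into one kernel-verified Lean document; each statement's English description precedes it below -/
import Mathlib

section
/- The space of square-mean ω-periodic limit processes is complete under the sup norm: if (X_n)_{n≥0} is a sequence of square-mean ω-periodic limit processes that is Cauchy with respect to ‖X‖_∞ = sup_{t≥0} (E‖X(t)‖²)^{1/2}, then there exists a square-mean ω-periodic limit process X such that ‖X_n − X‖_∞ → 0 as n → ∞. -/
open MeasureTheory Filter Topology

/-- `X` is a square-mean `ω`-periodic limit process with limit process `Xt` :
`X : [0,∞) → L²(ℙ,H)` is continuous and bounded (note that for `f ∈ L²(ℙ,H)` one has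
`E‖f‖² = ‖f‖²`, so square-mean statements are statements about the `L²` norm), and
for every `t ≥ 0`, `E‖X(t+nω) − Xt(t)‖² → 0` as `n → ∞`, `n ∈ ℕ`. -/
def IsPeriodicLimit {Ω : Type*} [MeasurableSpace Ω] (P : Measure Ω)
    {H : Type*} [NormedAddCommGroup H] (ω : ℝ) (X Xt : ℝ → Lp H 2 P) : Prop :=
  ContinuousOn X (Set.Ici 0) ∧
  (∃ K > 0, ∀ t ≥ (0:ℝ), ‖X t‖ ^ 2 ≤ K) ∧
  ∀ t ≥ (0:ℝ), Filter.Tendsto (fun n : ℕ => ‖X (t + n * ω) - Xt t‖ ^ 2)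
    Filter.atTop (nhds 0)

variable {Ω : Type*} [MeasurableSpace Ω] (P : Measure Ω) [IsProbabilityMeasure P]
  {H : Type*} [NormedAddCommGroup H] [InnerProductSpace ℝ H] [CompleteSpace H]
  [SecondCountableTopology H]

/-- A uniform limit of functions having a limit along `k ↦ t + k * ω` has such a limit too. -/
theorem exists_tendsto_of_tendstoUniformlyOn {E : Type*} [NormedAddCommGroup E] [CompleteSpace E]
    {ω : ℝ} (hω : 0 ≤ ω) {F : ℕ → ℝ → E} {Y : ℝ → E}
    (hFY : TendstoUniformlyOn F Y atTop (Set.Ici 0))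
    (hF : ∀ n, ∀ t ≥ (0 : ℝ), ∃ x, Tendsto (fun k : ℕ => F n (t + k * ω)) atTop (𝓝 x))
    {t : ℝ} (ht : 0 ≤ t) :
    ∃ x, Tendsto (fun k : ℕ => Y (t + k * ω)) atTop (𝓝 x) := by
  refine cauchySeq_tendsto_of_complete (Metric.cauchySeq_iff.2 fun ε hε => ?_)
  obtain ⟨n, hn⟩ := (Metric.tendstoUniformlyOn_iff.1 hFY (ε / 3) (by positivity)).exists
  obtain ⟨x, hx⟩ := hF n t ht
  obtain ⟨N, hN⟩ := Metric.cauchySeq_iff.1 hx.cauchySeq (ε / 3) (by positivity)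
  have hmem (k : ℕ) : t + k * ω ∈ Set.Ici (0 : ℝ) := Set.mem_Ici.2 (by positivity)
  refine ⟨N, fun k hk l hl => ?_⟩
  have hk' := hn _ (hmem k)
  have hl' := hn _ (hmem l)
  rw [dist_comm] at hl'
  linarith [hN k hk l hl, dist_triangle4 (Y (t + k * ω)) (F n (t + k * ω)) (F n (t + l * ω))
    (Y (t + l * ω))]

/-- A sequence which is uniformly Cauchy on `s` converges uniformly on `s`. -/
theorem exists_tendstoUniformlyOn_of_cauchy {α E : Type*} [NormedAddCommGroup E] [CompleteSpace E]
    {s : Set α} {F : ℕ → α → E}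
    (hF : ∀ ε > (0 : ℝ), ∃ N : ℕ, ∀ m ≥ N, ∀ n ≥ N, ∀ t ∈ s, ‖F m t - F n t‖ ≤ ε) :
    ∃ Y : α → E, TendstoUniformlyOn F Y atTop s := by
  have hunif : UniformCauchySeqOn F atTop s := by
    refine Metric.uniformCauchySeqOn_iff.2 fun ε hε => ?_
    obtain ⟨N, hN⟩ := hF (ε / 2) (by positivity)
    refine ⟨N, fun m hm n hn t ht => ?_⟩
    rw [dist_eq_norm]
    linarith [hN m hm n hn t ht]
  have hlim (t : α) : ∃ y, t ∈ s → Tendsto (fun n => F n t) atTop (𝓝 y) := by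
    by_cases ht : t ∈ s
    · obtain ⟨y, hy⟩ := cauchySeq_tendsto_of_complete (hunif.cauchySeq ht)
      exact ⟨y, fun _ => hy⟩
    · exact ⟨0, fun h => absurd h ht⟩
  choose Y hY using hlim
  exact ⟨Y, hunif.tendstoUniformlyOn_of_tendsto hY⟩

/-- the space of square-mean `ω`-periodic limit processes is complete
under the sup norm `‖X‖_∞ = sup_{t≥0} (E‖X(t)‖²)^{1/2}`: a sequence of square-mean
`ω`-periodic limit processes which is Cauchy in the sup norm converges in the sup norm
to a square-mean `ω`-periodic limit process. -/
theorem periodicLimit_complete (ω : ℝ) (hω : 0 < ω)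
    (X : ℕ → ℝ → Lp H 2 P)
    (hX : ∀ n : ℕ, ∃ Xt : ℝ → Lp H 2 P, IsPeriodicLimit P ω (X n) Xt)
    (hcauchy : ∀ ε > (0:ℝ), ∃ N : ℕ, ∀ m ≥ N, ∀ n ≥ N, ∀ t ≥ (0:ℝ),
      ‖X m t - X n t‖ ≤ ε) :
    ∃ Y Yt : ℝ → Lp H 2 P, IsPeriodicLimit P ω Y Yt ∧
      ∀ ε > (0:ℝ), ∃ N : ℕ, ∀ n ≥ N, ∀ t ≥ (0:ℝ), ‖X n t - Y t‖ ≤ ε := by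
  obtain ⟨Y, hXY⟩ := exists_tendstoUniformlyOn_of_cauchy (s := Set.Ici (0 : ℝ)) hcauchy
  have hdist := Metric.tendstoUniformlyOn_iff.1 hXY
  have hconv (n : ℕ) (t : ℝ) (ht : t ≥ 0) :
      ∃ x, Tendsto (fun k : ℕ => X n (t + k * ω)) atTop (𝓝 x) := by
    obtain ⟨Xt, -, -, hlim⟩ := hX n
    refine ⟨Xt t, tendsto_iff_norm_sub_tendsto_zero.2 ?_⟩
    simpa using (hlim t ht).sqrt
  have hYconv (t : ℝ) : ∃ x, t ≥ 0 → Tendsto (fun k : ℕ => Y (t + k * ω)) atTop (𝓝 x) := by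
    by_cases ht : t ≥ 0
    · obtain ⟨x, hx⟩ := exists_tendsto_of_tendstoUniformlyOn hω.le hXY hconv ht
      exact ⟨x, fun _ => hx⟩
    · exact ⟨0, fun h => absurd h ht⟩
  choose Yt hYt using hYconv
  refine ⟨Y, Yt, ⟨?_, ?_, fun t ht => ?_⟩, fun ε hε => ?_⟩
  · refine hXY.continuousOn (Eventually.frequently (Eventually.of_forall fun n => ?_))
    obtain ⟨_, hcont, -⟩ := hX n
    exact hcont
  · obtain ⟨n, hn⟩ := (hdist 1 one_pos).exists
    obtain ⟨_, -, ⟨K, hK, hbound⟩, -⟩ := hX n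
    refine ⟨(1 + √K) ^ 2, by positivity, fun t ht => ?_⟩
    have hYX := hn t ht
    rw [dist_eq_norm] at hYX
    have hXK : ‖X n t‖ ≤ √K := Real.le_sqrt_of_sq_le (hbound t ht)
    gcongr
    linarith [norm_sub_norm_le (Y t) (X n t)]
  · simpa using (tendsto_iff_norm_sub_tendsto_zero.1 (hYt t ht)).pow 2
  · obtain ⟨N, hN⟩ := eventually_atTop.1 (hdist ε hε)
    refine ⟨N, fun n hn t ht => ?_⟩
    rw [← dist_eq_norm, dist_comm]
    exact (hN n hn t ht).le
end

section
/- Let (X_i)_{i≥0} be a sequence of square-mean ω-periodic limit processes with respective limit processes X̃_i, and suppose (X_i) is Cauchy with respect to the sup norm ‖X‖_∞ = sup_{t≥0} (E‖X(t)‖²)^{1/2}. Then for each fixed t ≥ 0, the sequence (X̃_i(t))_{i≥0} is a Cauchy sequence in L²(ℙ,H). -/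
open MeasureTheory Filter Topology

/-- The translates `X (t + n * ω)` of a periodic limit process converge in `L²` to its limit
process. -/
lemma IsPeriodicLimit.tendsto {Ω : Type*} [MeasurableSpace Ω] {P : Measure Ω}
    {H : Type*} [NormedAddCommGroup H] {ω : ℝ} {X Xt : ℝ → Lp H 2 P}
    (h : IsPeriodicLimit P ω X Xt) {t : ℝ} (ht : 0 ≤ t) :
    Tendsto (fun n : ℕ => X (t + n * ω)) atTop (𝓝 (Xt t)) := by
  rw [tendsto_iff_norm_sub_tendsto_zero]
  simpa using (h.2.2 t ht).sqrt

variable {Ω : Type*} [MeasurableSpace Ω] (P : Measure Ω) [IsProbabilityMeasure P]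
  {H : Type*} [NormedAddCommGroup H] [InnerProductSpace ℝ H] [CompleteSpace H]
  [SecondCountableTopology H]

/-- if `(X i)` is a sequence of square-mean `ω`-periodic limit processes
with respective limit processes `(Xt i)`, and `(X i)` is Cauchy with respect to the sup
norm `‖X‖_∞ = sup_{t≥0} (E‖X(t)‖²)^{1/2}`, then for each fixed `t ≥ 0` the sequence
`(Xt i t)` is Cauchy in `L²(ℙ,H)`. -/
theorem limit_processes_cauchy (ω : ℝ) (hω : 0 < ω)
    (X Xt : ℕ → ℝ → Lp H 2 P)
    (hX : ∀ i : ℕ, IsPeriodicLimit P ω (X i) (Xt i))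
    (hcauchy : ∀ ε > (0:ℝ), ∃ N : ℕ, ∀ m ≥ N, ∀ n ≥ N, ∀ t ≥ (0:ℝ),
      ‖X m t - X n t‖ ≤ ε) :
    ∀ t ≥ (0:ℝ), CauchySeq (fun i : ℕ => Xt i t) := by
  intro t ht
  refine Metric.cauchySeq_iff'.2 fun ε hε => ?_
  obtain ⟨N, hN⟩ := hcauchy (ε / 2) (half_pos hε)
  refine ⟨N, fun n hn => ?_⟩
  rw [dist_eq_norm]
  refine lt_of_le_of_lt ?_ (half_lt_self hε)
  exact le_of_tendsto' (((hX n).tendsto ht).sub ((hX N).tendsto ht)).norm fun k =>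
    hN n hn N le_rfl _ (by positivity)
end

section
/- The set of square-mean asymptotically ω-periodic processes is closed under uniform convergence: if (X_n) is a sequence of square-mean asymptotically ω-periodic processes and X is a continuous bounded process with sup_{t≥0} E‖X_n(t) − X(t)‖² → 0 as n → ∞, then X is square-mean asymptotically ω-periodic. -/
open MeasureTheory Filter Topology

/-- `X` is a square-mean asymptotically `ω`-periodic process: `X` is a continuous
bounded process decomposing as `X = Y + Z` on `[0,∞)` where `Y, Z` are continuous
bounded processes with `E‖Y(t+ω) − Y(t)‖² = 0` for all `t ≥ 0` and
`E‖Z(t)‖² → 0` as `t → ∞` (recall `E‖f‖² = ‖f‖²` for `f ∈ L²(ℙ,H)`). -/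
def IsAsympPeriodic {Ω : Type*} [MeasurableSpace Ω] (P : Measure Ω)
    {H : Type*} [NormedAddCommGroup H] (ω : ℝ) (X : ℝ → Lp H 2 P) : Prop :=
  ContinuousOn X (Set.Ici 0) ∧
  (∃ K > 0, ∀ t ≥ (0:ℝ), ‖X t‖ ^ 2 ≤ K) ∧
  ∃ Y Z : ℝ → Lp H 2 P,
    (∀ t ≥ (0:ℝ), X t = Y t + Z t) ∧
    ContinuousOn Y (Set.Ici 0) ∧ (∃ K > 0, ∀ t ≥ (0:ℝ), ‖Y t‖ ^ 2 ≤ K) ∧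
    ContinuousOn Z (Set.Ici 0) ∧ (∃ K > 0, ∀ t ≥ (0:ℝ), ‖Z t‖ ^ 2 ≤ K) ∧
    (∀ t ≥ (0:ℝ), ‖Y (t + ω) - Y t‖ ^ 2 = 0) ∧
    Filter.Tendsto (fun t : ℝ => ‖Z t‖ ^ 2) Filter.atTop (nhds 0)

variable {Ω : Type*} [MeasurableSpace Ω] (P : Measure Ω) [IsProbabilityMeasure P]
  {H : Type*} [NormedAddCommGroup H] [InnerProductSpace ℝ H] [CompleteSpace H]
  [SecondCountableTopology H]

/-- A bounded continuous function on `[0,∞)` that is eventually uniformly approximated by continuous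
`ω`-periodic functions has a periodic part: a continuous `ω`-periodic function, subject to the same
bound, from which its distance tends to `0` at infinity. -/
theorem exists_periodic_part {E : Type*} [NormedAddCommGroup E] [CompleteSpace E]
    {ω : ℝ} (hω : 0 < ω) {f : ℝ → E} {C : ℝ} (hC : ∀ t ≥ (0:ℝ), ‖f t‖ ≤ C)
    (happ : ∀ ε > (0:ℝ), ∃ p : ℝ → E, ContinuousOn p (Set.Ici 0) ∧
      (∀ t ≥ (0:ℝ), p (t + ω) = p t) ∧ ∃ S : ℝ, ∀ s ≥ S, 0 ≤ s → ‖f s - p s‖ ≤ ε) :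
    ∃ g : ℝ → E, ContinuousOn g (Set.Ici 0) ∧ (∀ t ≥ (0:ℝ), ‖g t‖ ≤ C) ∧
      (∀ t ≥ (0:ℝ), g (t + ω) = g t) ∧ Tendsto (fun t => f t - g t) atTop (𝓝 0) := by
  have hshift : ∀ {t : ℝ}, 0 ≤ t → ∀ k : ℕ, 0 ≤ t + k * ω := fun ht k => by positivity
  have hper : ∀ {p : ℝ → E}, (∀ t ≥ (0:ℝ), p (t + ω) = p t) →
      ∀ t ≥ (0:ℝ), ∀ k : ℕ, p (t + k * ω) = p t := by
    intro p hp t ht k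
    induction k with
    | zero => simp
    | succ k ih =>
      rw [← ih, ← hp _ (hshift ht k)]
      congr 1
      push_cast
      ring
  have hnear : ∀ {p : ℝ → E} {S ε : ℝ}, (∀ t ≥ (0:ℝ), p (t + ω) = p t) →
      (∀ s ≥ S, 0 ≤ s → ‖f s - p s‖ ≤ ε) →
      ∀ t ≥ (0:ℝ), ∀ᶠ k : ℕ in atTop, ‖f (t + k * ω) - p t‖ ≤ ε := by
    intro p S ε hp hS t ht
    have hlim : Tendsto (fun k : ℕ => t + k * ω) atTop atTop :=
      tendsto_atTop_add_const_left _ _ (tendsto_natCast_atTop_atTop.atTop_mul_const hω)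
    filter_upwards [hlim.eventually_ge_atTop S] with k hk
    rw [← hper hp t ht k]
    exact hS _ hk (hshift ht k)
  have hconv : ∀ t : ℝ, ∃ y : E, 0 ≤ t → Tendsto (fun k : ℕ => f (t + k * ω)) atTop (𝓝 y) := by
    intro t
    by_cases ht : 0 ≤ t
    · have hcauchy : CauchySeq fun k : ℕ => f (t + k * ω) := by
        refine Metric.cauchySeq_iff'.2 fun ε hε => ?_
        obtain ⟨p, -, hp, S, hS⟩ := happ (ε / 3) (by positivity)
        obtain ⟨N, hN⟩ := eventually_atTop.1 (hnear hp hS t ht)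
        refine ⟨N, fun n hn => ?_⟩
        have h₁ := hN n hn
        have h₂ := hN N le_rfl
        rw [← dist_eq_norm] at h₁ h₂
        linarith [dist_triangle_right (f (t + n * ω)) (f (t + N * ω)) (p t)]
      obtain ⟨y, hy⟩ := cauchySeq_tendsto_of_complete hcauchy
      exact ⟨y, fun _ => hy⟩
    · exact ⟨0, fun h => absurd h ht⟩
  choose g hg using hconv
  have hclose : ∀ {p : ℝ → E} {S ε : ℝ}, (∀ t ≥ (0:ℝ), p (t + ω) = p t) →
      (∀ s ≥ S, 0 ≤ s → ‖f s - p s‖ ≤ ε) → ∀ t ≥ (0:ℝ), ‖g t - p t‖ ≤ ε :=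
    fun hp hS t ht =>
      le_of_tendsto ((hg t ht).sub tendsto_const_nhds).norm (hnear hp hS t ht)
  refine ⟨g, ?_, fun t ht => ?_, fun t ht => ?_, ?_⟩
  · refine continuousOn_of_uniform_approx_of_continuousOn fun u hu => ?_
    obtain ⟨ε, hε, hεu⟩ := Metric.mem_uniformity_dist.1 hu
    obtain ⟨p, hpc, hp, S, hS⟩ := happ (ε / 2) (by positivity)
    refine ⟨p, hpc, fun t ht => hεu ?_⟩
    rw [dist_eq_norm]
    linarith [hclose hp hS t ht]
  · exact le_of_tendsto (hg t ht).norm (Eventually.of_forall fun k => hC _ (hshift ht k))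
  · refine tendsto_nhds_unique (hg (t + ω) (by positivity)) ?_
    refine ((hg t ht).comp (tendsto_add_atTop_nat 1)).congr fun k => ?_
    simp only [Function.comp_apply]
    congr 1
    push_cast
    ring
  · refine Metric.tendsto_atTop.2 fun ε hε => ?_
    obtain ⟨p, -, hp, S, hS⟩ := happ (ε / 3) (by positivity)
    refine ⟨max S 0, fun t ht => ?_⟩
    have ht₀ : 0 ≤ t := (le_max_right _ _).trans ht
    have h₁ := hS t ((le_max_left _ _).trans ht) ht₀
    have h₂ := hclose hp hS t ht₀
    rw [dist_zero_right, ← dist_eq_norm]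
    rw [← dist_eq_norm] at h₁ h₂
    linarith [dist_triangle_right (f t) (g t) (p t)]

/-- the set of square-mean asymptotically `ω`-periodic processes is
closed under uniform convergence (in the square-mean sense). -/
theorem asympPeriodic_closed (ω : ℝ) (hω : 0 < ω)
    (X : ℕ → ℝ → Lp H 2 P) (hX : ∀ n : ℕ, IsAsympPeriodic P ω (X n))
    (Y : ℝ → Lp H 2 P)
    (hYc : ContinuousOn Y (Set.Ici 0)) (hYb : ∃ K > 0, ∀ t ≥ (0:ℝ), ‖Y t‖ ^ 2 ≤ K)
    (hconv : ∀ ε > (0:ℝ), ∃ N : ℕ, ∀ n ≥ N, ∀ t ≥ (0:ℝ), ‖X n t - Y t‖ ^ 2 ≤ ε) :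
    IsAsympPeriodic P ω Y := by
  obtain ⟨K, hK, hYK⟩ := hYb
  have hYC : ∀ t ≥ (0:ℝ), ‖Y t‖ ≤ √K := fun t ht => Real.le_sqrt_of_sq_le (hYK t ht)
  have hsq : √K ^ 2 = K := Real.sq_sqrt hK.le
  obtain ⟨G, hGc, hGb, hGp, hGl⟩ := exists_periodic_part hω hYC (by
    intro ε hε
    obtain ⟨N, hN⟩ := hconv ((ε / 2) ^ 2) (by positivity)
    obtain ⟨-, -, p, Z, hXpZ, hpc, -, -, -, hp, hZ⟩ := hX N
    refine ⟨p, hpc, fun t ht => sub_eq_zero.1 (norm_eq_zero.1 (pow_eq_zero_iff two_ne_zero |>.1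
      (hp t ht))), ?_⟩
    obtain ⟨S, hS⟩ := eventually_atTop.1
      (hZ.eventually_le_const (show (0:ℝ) < (ε / 2) ^ 2 by positivity))
    refine ⟨S, fun s hs hs₀ => ?_⟩
    have h₁ : ‖X N s - Y s‖ ≤ ε / 2 :=
      (pow_le_pow_iff_left₀ (norm_nonneg _) (by positivity) two_ne_zero).1 (hN N le_rfl s hs₀)
    have h₂ : ‖Z s‖ ≤ ε / 2 :=
      (pow_le_pow_iff_left₀ (norm_nonneg _) (by positivity) two_ne_zero).1 (hS s hs)
    have h₃ : Y s - p s = Z s - (X N s - Y s) := by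
      rw [hXpZ s hs₀]
      abel
    rw [h₃]
    linarith [norm_sub_le (Z s) (X N s - Y s)])
  refine ⟨hYc, ⟨K, hK, hYK⟩, G, fun t => Y t - G t, fun t _ => (add_sub_cancel (G t) (Y t)).symm, hGc,
    ⟨K, hK, fun t ht => ?_⟩, hYc.sub hGc, ⟨(√K + √K) ^ 2, by positivity, fun t ht => ?_⟩,
    fun t ht => by simp [hGp t ht], by simpa using hGl.norm.pow 2⟩
  · rw [← hsq]
    gcongr
    exact hGb t ht
  · gcongr
    exact (norm_sub_le _ _).trans (add_le_add (hYC t ht) (hGb t ht))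
end

section
/- The space of square-mean asymptotically ω-periodic processes is complete under the sup norm: if (X_n) is a sequence of square-mean asymptotically ω-periodic processes that is Cauchy with respect to ‖X‖_∞ = sup_{t≥0} (E‖X(t)‖²)^{1/2}, then there exists a square-mean asymptotically ω-periodic process X with ‖X_n − X‖_∞ → 0 as n → ∞. -/
open MeasureTheory Filter Topology

variable {Ω : Type*} [MeasurableSpace Ω] (P : Measure Ω) [IsProbabilityMeasure P]
  {H : Type*} [NormedAddCommGroup H] [InnerProductSpace ℝ H] [CompleteSpace H]
  [SecondCountableTopology H]

/-- A bound on the squared norms is equivalent to a bound on the norms. -/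
theorem exists_norm_sq_le_iff {E : Type*} [NormedAddCommGroup E] (F : ℝ → E) :
    (∃ K > 0, ∀ t ≥ (0:ℝ), ‖F t‖ ^ 2 ≤ K) ↔ ∃ K : ℝ, ∀ t ≥ (0:ℝ), ‖F t‖ ≤ K := by
  constructor
  · rintro ⟨K, -, h⟩
    exact ⟨√K, fun t ht => Real.le_sqrt_of_sq_le (h t ht)⟩
  · rintro ⟨K, h⟩
    refine ⟨K ^ 2 + 1, by positivity, fun t ht => ?_⟩
    have := pow_le_pow_left₀ (norm_nonneg _) (h t ht) 2
    linarith

/-- A sequence of continuous bounded functions on `[0,∞)` that is Cauchy for the sup norm converges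
uniformly to a continuous bounded function. -/
theorem exists_uniform_limit_on_Ici {E : Type*} [NormedAddCommGroup E] [CompleteSpace E]
    (F : ℕ → ℝ → E) (hc : ∀ n, ContinuousOn (F n) (Set.Ici 0))
    (hb : ∀ n, ∃ K : ℝ, ∀ t ≥ (0:ℝ), ‖F n t‖ ≤ K)
    (hF : ∀ ε > (0:ℝ), ∃ N : ℕ, ∀ m ≥ N, ∀ n ≥ N, ∀ t ≥ (0:ℝ), ‖F m t - F n t‖ ≤ ε) :
    ∃ G : ℝ → E, ContinuousOn G (Set.Ici 0) ∧ (∃ K : ℝ, ∀ t ≥ (0:ℝ), ‖G t‖ ≤ K) ∧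
      ∀ ε > (0:ℝ), ∃ N : ℕ, ∀ n ≥ N, ∀ t ≥ (0:ℝ), ‖F n t - G t‖ ≤ ε := by
  have hlim : ∀ t, ∃ x, t ≥ (0:ℝ) → Tendsto (fun n => F n t) atTop (𝓝 x) := by
    intro t
    by_cases ht : t ≥ 0
    · have : CauchySeq fun n => F n t := by
        refine Metric.cauchySeq_iff.2 fun ε hε => ?_
        obtain ⟨N, hN⟩ := hF (ε / 2) (by positivity)
        refine ⟨N, fun m hm n hn => ?_⟩
        rw [dist_eq_norm]
        linarith [hN m hm n hn t ht]
      obtain ⟨x, hx⟩ := cauchySeq_tendsto_of_complete this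
      exact ⟨x, fun _ => hx⟩
    · exact ⟨0, fun h => absurd h ht⟩
  choose G hG using hlim
  have hunif : ∀ ε > (0:ℝ), ∃ N : ℕ, ∀ n ≥ N, ∀ t ≥ (0:ℝ), ‖F n t - G t‖ ≤ ε := by
    intro ε hε
    obtain ⟨N, hN⟩ := hF ε hε
    refine ⟨N, fun n hn t ht => ?_⟩
    refine le_of_tendsto ((hG t ht).const_sub (F n t)).norm ?_
    filter_upwards [eventually_ge_atTop N] with m hm using hN n hn m hm t ht
  refine ⟨G, ?_, ?_, hunif⟩
  · have hU : TendstoUniformlyOn F G atTop (Set.Ici 0) := by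
      refine Metric.tendstoUniformlyOn_iff.2 fun ε hε => ?_
      obtain ⟨N, hN⟩ := hunif (ε / 2) (by positivity)
      filter_upwards [eventually_ge_atTop N] with n hn t ht
      rw [dist_comm, dist_eq_norm]
      linarith [hN n hn t ht]
    exact hU.continuousOn (Frequently.of_forall hc)
  · obtain ⟨N, hN⟩ := hunif 1 one_pos
    obtain ⟨K, hK⟩ := hb N
    refine ⟨K + 1, fun t ht => ?_⟩
    have h := norm_sub_le (F N t) (F N t - G t)
    rw [sub_sub_cancel] at h
    linarith [hK t ht, hN N le_rfl t ht]

/-- A function that is `ω`-periodic on `[0,∞)` is bounded by any bound for the sum of it and a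
function vanishing at infinity. -/
theorem norm_le_of_periodic_of_tendsto_zero {E : Type*} [NormedAddCommGroup E] {ω : ℝ} (hω : 0 < ω)
    {Y Z : ℝ → E} (hY : ∀ t ≥ (0:ℝ), Y (t + ω) = Y t) (hZ : Tendsto Z atTop (𝓝 0)) {ε : ℝ}
    (h : ∀ t ≥ (0:ℝ), ‖Y t + Z t‖ ≤ ε) {t : ℝ} (ht : t ≥ 0) : ‖Y t‖ ≤ ε := by
  have hper : ∀ k : ℕ, Y (t + k * ω) = Y t := by
    intro k
    induction k with
    | zero => simp
    | succ k ih =>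
      rw [← ih, ← hY (t + k * ω) (by positivity)]
      congr 1
      push_cast
      ring
  have hk : Tendsto (fun k : ℕ => t + k * ω) atTop atTop :=
    tendsto_atTop_add_const_left _ _ (tendsto_natCast_atTop_atTop.atTop_mul_const hω)
  have hlim : Tendsto (fun k : ℕ => ‖Y t + Z (t + k * ω)‖) atTop (𝓝 ‖Y t‖) := by
    simpa using ((hZ.comp hk).const_add (Y t)).norm
  refine le_of_tendsto hlim (Eventually.of_forall fun k => ?_)
  have := h (t + k * ω) (by positivity)
  rwa [hper k] at this

/-- Convergence of squared norms to zero is convergence to zero. -/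
theorem tendsto_norm_sq_zero_iff {E : Type*} [NormedAddCommGroup E] {Z : ℝ → E} :
    Tendsto (fun t => ‖Z t‖ ^ 2) atTop (𝓝 0) ↔ Tendsto Z atTop (𝓝 0) := by
  rw [tendsto_zero_iff_norm_tendsto_zero (f := Z)]
  constructor
  · intro h
    simpa using h.sqrt
  · intro h
    simpa using h.pow 2

/-- the space of square-mean asymptotically `ω`-periodic processes is
complete under the sup norm `‖X‖_∞ = sup_{t≥0} (E‖X(t)‖²)^{1/2}`. -/
theorem asympPeriodic_complete (ω : ℝ) (hω : 0 < ω)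
    (X : ℕ → ℝ → Lp H 2 P) (hX : ∀ n : ℕ, IsAsympPeriodic P ω (X n))
    (hcauchy : ∀ ε > (0:ℝ), ∃ N : ℕ, ∀ m ≥ N, ∀ n ≥ N, ∀ t ≥ (0:ℝ),
      ‖X m t - X n t‖ ≤ ε) :
    ∃ Y : ℝ → Lp H 2 P, IsAsympPeriodic P ω Y ∧
      ∀ ε > (0:ℝ), ∃ N : ℕ, ∀ n ≥ N, ∀ t ≥ (0:ℝ), ‖X n t - Y t‖ ≤ ε := by
  choose _ _ Y Z hXYZ hYc hYb hZc hZb hYp hZ0 using hX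
  simp only [exists_norm_sq_le_iff] at hYb hZb
  simp only [tendsto_norm_sq_zero_iff] at hZ0
  have hYper : ∀ n, ∀ t ≥ (0:ℝ), Y n (t + ω) = Y n t := fun n t ht => by
    simpa [sub_eq_zero] using hYp n t ht
  have hYcauchy : ∀ ε > (0:ℝ), ∃ N : ℕ, ∀ m ≥ N, ∀ n ≥ N, ∀ t ≥ (0:ℝ),
      ‖Y m t - Y n t‖ ≤ ε := by
    intro ε hε
    obtain ⟨N, hN⟩ := hcauchy ε hε
    refine ⟨N, fun m hm n hn t ht => ?_⟩
    refine norm_le_of_periodic_of_tendsto_zero (Y := fun t => Y m t - Y n t)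
      (Z := fun t => Z m t - Z n t) hω (fun s hs => ?_) ?_ (fun s hs => ?_) ht
    · simp only [hYper _ s hs]
    · simpa using (hZ0 m).sub (hZ0 n)
    · rw [sub_add_sub_comm, ← hXYZ m s hs, ← hXYZ n s hs]
      exact hN m hm n hn s hs
  have hZcauchy : ∀ ε > (0:ℝ), ∃ N : ℕ, ∀ m ≥ N, ∀ n ≥ N, ∀ t ≥ (0:ℝ),
      ‖Z m t - Z n t‖ ≤ ε := by
    intro ε hε
    obtain ⟨N₁, hN₁⟩ := hcauchy (ε / 2) (by positivity)
    obtain ⟨N₂, hN₂⟩ := hYcauchy (ε / 2) (by positivity)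
    refine ⟨max N₁ N₂, fun m hm n hn t ht => ?_⟩
    have h₁ := hN₁ m (le_of_max_le_left hm) n (le_of_max_le_left hn) t ht
    have h₂ := hN₂ m (le_of_max_le_right hm) n (le_of_max_le_right hn) t ht
    have h : Z m t - Z n t = (X m t - X n t) - (Y m t - Y n t) := by
      rw [hXYZ m t ht, hXYZ n t ht]
      abel
    rw [h]
    linarith [norm_sub_le (X m t - X n t) (Y m t - Y n t)]
  obtain ⟨A, hAc, hAb, hA⟩ := exists_uniform_limit_on_Ici Y hYc hYb hYcauchy
  obtain ⟨B, hBc, hBb, hB⟩ := exists_uniform_limit_on_Ici Z hZc hZb hZcauchy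
  refine ⟨fun t => A t + B t, ⟨hAc.add hBc, ?_, A, B, fun _ _ => rfl, hAc,
    (exists_norm_sq_le_iff A).2 hAb, hBc, (exists_norm_sq_le_iff B).2 hBb, fun t ht => ?_,
    tendsto_norm_sq_zero_iff.2 ?_⟩, fun ε hε => ?_⟩
  · obtain ⟨K, hK⟩ := hAb
    obtain ⟨L, hL⟩ := hBb
    exact (exists_norm_sq_le_iff _).2
      ⟨K + L, fun t ht => norm_add_le_of_le (hK t ht) (hL t ht)⟩
  · suffices h : ‖A (t + ω) - A t‖ ≤ 0 by
      rw [le_antisymm h (norm_nonneg _), zero_pow two_ne_zero]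
    refine le_of_forall_pos_le_add fun ε hε => ?_
    obtain ⟨N, hN⟩ := hA (ε / 2) (by positivity)
    have h₁ := hN N le_rfl t ht
    have h₂ := hN N le_rfl (t + ω) (by positivity)
    rw [hYper N t ht] at h₂
    have h : A (t + ω) - A t = (Y N t - A t) - (Y N t - A (t + ω)) := by abel
    rw [h]
    linarith [norm_sub_le (Y N t - A t) (Y N t - A (t + ω))]
  · refine Metric.tendsto_nhds.2 fun ε hε => ?_
    obtain ⟨N, hN⟩ := hB (ε / 2) (by positivity)
    filter_upwards [Metric.tendsto_nhds.1 (hZ0 N) (ε / 2) (by positivity),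
      eventually_ge_atTop 0] with t h₁ ht
    rw [dist_zero_right] at h₁ ⊢
    have h := norm_sub_le (Z N t) (Z N t - B t)
    rw [sub_sub_cancel] at h
    linarith [hN N le_rfl t ht]
  · obtain ⟨N₁, hN₁⟩ := hA (ε / 2) (by positivity)
    obtain ⟨N₂, hN₂⟩ := hB (ε / 2) (by positivity)
    refine ⟨max N₁ N₂, fun n hn t ht => ?_⟩
    rw [hXYZ n t ht, add_sub_add_comm]
    linarith [norm_add_le (Y n t - A t) (Z n t - B t), hN₁ n (le_of_max_le_left hn) t ht,
      hN₂ n (le_of_max_le_right hn) t ht]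
end

section
/- Let X be a continuous bounded process and ω > 0. The following statements are equivalent: (i) X is square-mean asymptotically ω-periodic; (ii) there exists a process Y : [0,∞) → L²(ℙ,H) such that E‖X(t+nω) − Y(t)‖² → 0 as n → ∞ uniformly in t ∈ [0,∞); (iii) there exists a process Y : [0,∞) → L²(ℙ,H) such that E‖X(t+nω) − Y(t)‖² → 0 as n → ∞ uniformly on every compact subset of [0,∞); (iv) there exists a process Y : [0,∞) → L²(ℙ,H) such that E‖X(t+nω) − Y(t)‖² → 0 as n → ∞ uniformly in t ∈ [0,ω]. -/
open MeasureTheory Filter Topology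

section PeriodicLimit

variable {α E : Type*} [NormedAddCommGroup E]

/-- The extension of `Y : [0, ω) → α` to a function on `[0, ∞)` that is `ω`-periodic there. -/
noncomputable def natPeriodicExtension (ω : ℝ) (Y : ℝ → α) (t : ℝ) : α :=
  Y (t - ⌊t / ω⌋₊ * ω)

theorem sub_natFloor_div_mul_mem_Icc {ω t : ℝ} (hω : 0 < ω) (ht : 0 ≤ t) :
    t - ⌊t / ω⌋₊ * ω ∈ Set.Icc 0 ω := by
  have h₁ := (le_div_iff₀ hω).1 (Nat.floor_le (div_nonneg ht hω.le))
  have h₂ := (div_lt_iff₀ hω).1 (Nat.lt_floor_add_one (t / ω))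
  constructor <;> linarith

theorem natPeriodicExtension_add {ω t : ℝ} (hω : 0 < ω) (ht : 0 ≤ t) (Y : ℝ → α) :
    natPeriodicExtension ω Y (t + ω) = natPeriodicExtension ω Y t := by
  have h : ⌊(t + ω) / ω⌋₊ = ⌊t / ω⌋₊ + 1 := by
    rw [add_div, div_self hω.ne', Nat.floor_add_one (div_nonneg ht hω.le)]
  unfold natPeriodicExtension
  rw [h]
  congr 1
  push_cast
  ring

theorem add_nat_mul_eq_of_forall_add_eq {ω : ℝ} (hω : 0 < ω) {Y : ℝ → α}
    (hY : ∀ t ≥ (0 : ℝ), Y (t + ω) = Y t) (n : ℕ) {t : ℝ} (ht : 0 ≤ t) :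
    Y (t + n * ω) = Y t := by
  induction n with
  | zero => simp
  | succ n ih =>
    rw [← ih, ← hY (t + n * ω) (by positivity)]
    congr 1
    push_cast
    ring

/-- Uniform convergence of the translates on one period extends to the whole half-line. -/
theorem tendstoUniformlyOn_natPeriodicExtension {ω : ℝ} (hω : 0 < ω) {X Y : ℝ → E}
    (h : ∀ ε > (0 : ℝ), ∃ N : ℕ, ∀ n ≥ N, ∀ t ∈ Set.Icc (0 : ℝ) ω,
      ‖X (t + n * ω) - Y t‖ ^ 2 < ε) :
    TendstoUniformlyOn (fun (n : ℕ) t => X (t + n * ω)) (natPeriodicExtension ω Y) atTop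
      (Set.Ici 0) := by
  rw [Metric.tendstoUniformlyOn_iff]
  intro ε hε
  obtain ⟨N, hN⟩ := h (ε ^ 2) (by positivity)
  filter_upwards [eventually_ge_atTop N] with n hn t ht
  have h₁ := hN (n + ⌊t / ω⌋₊) (by omega) _ (sub_natFloor_div_mul_mem_Icc hω ht)
  rw [dist_comm, dist_eq_norm]
  refine lt_of_pow_lt_pow_left₀ 2 hε.le ?_
  have h₂ : t - ⌊t / ω⌋₊ * ω + ↑(n + ⌊t / ω⌋₊) * ω = t + n * ω := by
    push_cast
    ring
  rw [h₂] at h₁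
  exact h₁

/-- If the translates of `X` by multiples of `ω` converge uniformly on `[0, ∞)` to an
`ω`-periodic function, then `X` is asymptotic to that function at infinity. -/
theorem tendsto_norm_sub_of_tendstoUniformlyOn {ω : ℝ} (hω : 0 < ω) {X W : ℝ → E}
    (hW : ∀ t ≥ (0 : ℝ), W (t + ω) = W t)
    (h : TendstoUniformlyOn (fun (n : ℕ) t => X (t + n * ω)) W atTop (Set.Ici 0)) :
    Tendsto (fun t => ‖X t - W t‖) atTop (𝓝 0) := by
  rw [Metric.tendsto_atTop]
  intro ε hε
  obtain ⟨N, hN⟩ := (Metric.tendstoUniformlyOn_iff.1 h ε hε).exists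
  refine ⟨N * ω, fun t ht => ?_⟩
  have h₀ : 0 ≤ t - N * ω := sub_nonneg.2 ht
  have h₁ := hN (t - N * ω) h₀
  rw [← add_nat_mul_eq_of_forall_add_eq hω hW N h₀, sub_add_cancel, dist_comm,
    dist_eq_norm] at h₁
  simpa using h₁

end PeriodicLimit

variable {Ω : Type*} [MeasurableSpace Ω] (P : Measure Ω) [IsProbabilityMeasure P]
  {H : Type*} [NormedAddCommGroup H] [InnerProductSpace ℝ H] [CompleteSpace H]
  [SecondCountableTopology H]

/-- for a continuous bounded process `X` and `ω > 0`, the following are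
equivalent: (i) `X` is square-mean asymptotically `ω`-periodic; (ii) there is a process
`Y` with `E‖X(t+nω) − Y(t)‖² → 0` uniformly in `t ∈ [0,∞)`; (iii) there is a process `Y`
with `E‖X(t+nω) − Y(t)‖² → 0` uniformly on every compact subset of `[0,∞)`; (iv) there
is a process `Y` with `E‖X(t+nω) − Y(t)‖² → 0` uniformly in `t ∈ [0,ω]`. -/
theorem asympPeriodic_tfae (ω : ℝ) (hω : 0 < ω)
    (X : ℝ → Lp H 2 P)
    (hXc : ContinuousOn X (Set.Ici 0)) (hXb : ∃ K > 0, ∀ t ≥ (0:ℝ), ‖X t‖ ^ 2 ≤ K) :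
    List.TFAE
      [ IsAsympPeriodic P ω X,
        ∃ Y : ℝ → Lp H 2 P, ∀ ε > (0:ℝ), ∃ N : ℕ, ∀ n ≥ N, ∀ t ≥ (0:ℝ),
          ‖X (t + n * ω) - Y t‖ ^ 2 < ε,
        ∃ Y : ℝ → Lp H 2 P, ∀ K : Set ℝ, K ⊆ Set.Ici 0 → IsCompact K →
          ∀ ε > (0:ℝ), ∃ N : ℕ, ∀ n ≥ N, ∀ t ∈ K, ‖X (t + n * ω) - Y t‖ ^ 2 < ε,
        ∃ Y : ℝ → Lp H 2 P, ∀ ε > (0:ℝ), ∃ N : ℕ, ∀ n ≥ N, ∀ t ∈ Set.Icc (0:ℝ) ω,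
          ‖X (t + n * ω) - Y t‖ ^ 2 < ε ] := by
  tfae_have 1 → 2 := by
    rintro ⟨-, -, Y, Z, hXYZ, -, -, -, -, hY, hZ⟩
    have hY' : ∀ t ≥ (0 : ℝ), Y (t + ω) = Y t := fun t ht =>
      sub_eq_zero.1 (norm_eq_zero.1 (pow_eq_zero_iff two_ne_zero |>.1 (hY t ht)))
    refine ⟨Y, fun ε hε => ?_⟩
    obtain ⟨T, hT⟩ := eventually_atTop.1 (hZ.eventually_lt_const hε)
    obtain ⟨N, hN⟩ := exists_nat_ge (T / ω)
    refine ⟨N, fun n hn t ht => ?_⟩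
    have h₁ : T ≤ n * ω :=
      ((div_le_iff₀ hω).1 hN).trans (by gcongr)
    rw [hXYZ _ (by positivity), add_nat_mul_eq_of_forall_add_eq hω hY' n ht,
      add_sub_cancel_left]
    exact hT _ (by linarith)
  tfae_have 2 → 3 := by
    rintro ⟨Y, hY⟩
    refine ⟨Y, fun K hK _ ε hε => ?_⟩
    obtain ⟨N, hN⟩ := hY ε hε
    exact ⟨N, fun n hn t ht => hN n hn t (hK ht)⟩
  tfae_have 3 → 4 := fun ⟨Y, hY⟩ => ⟨Y, hY _ Set.Icc_subset_Ici_self isCompact_Icc⟩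
  tfae_have 4 → 1 := by
    rintro ⟨Y, hY⟩
    set W := natPeriodicExtension ω Y
    have hW : ∀ t ≥ (0 : ℝ), W (t + ω) = W t := fun t ht => natPeriodicExtension_add hω ht Y
    have hlim := tendstoUniformlyOn_natPeriodicExtension hω hY
    have hWc : ContinuousOn W (Set.Ici 0) := by
      refine hlim.continuousOn (Frequently.of_forall fun n => ?_)
      refine hXc.comp (by fun_prop) fun t (ht : 0 ≤ t) => ?_
      exact Set.mem_Ici.2 (by positivity)
    obtain ⟨K, hK, hXK⟩ := hXb
    have hX1 : ∀ t ≥ (0 : ℝ), ‖X t‖ ≤ K + 1 := fun t ht => by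
      nlinarith [hXK t ht, sq_nonneg (‖X t‖ - 1)]
    have hW1 : ∀ t ≥ (0 : ℝ), ‖W t‖ ≤ K + 1 := fun t ht =>
      le_of_tendsto (hlim.tendsto_at ht).norm
        (Eventually.of_forall fun n => hX1 _ (by positivity))
    refine ⟨hXc, ⟨K, hK, hXK⟩, W, X - W, fun t _ => by simp, hWc,
      ⟨(K + 1) ^ 2, by positivity, fun t ht => by gcongr; exact hW1 t ht⟩, hXc.sub hWc,
      ⟨(K + 1 + (K + 1)) ^ 2, by positivity, fun t ht => ?_⟩, fun t ht => by simp [hW t ht], ?_⟩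
    · gcongr
      exact norm_sub_le_of_le (hX1 t ht) (hW1 t ht)
    · simpa using (tendsto_norm_sub_of_tendstoUniformlyOn hω hW hlim).pow 2
  tfae_finish
end

section
/- Let X be a continuous bounded process, ω > 0, and Y : [0,∞) → L²(ℙ,H) a process such that E‖X(t+nω) − Y(t)‖² → 0 as n → ∞ for every t ≥ 0, with the convergence uniform for t ∈ [0,ω]. Then Y is bounded, Y is continuous on [0,∞), and E‖Y(t+ω) − Y(t)‖² = 0 for every t ≥ 0. -/
open MeasureTheory Filter Topology

variable {Ω : Type*} [MeasurableSpace Ω] (P : Measure Ω) [IsProbabilityMeasure P]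
  {H : Type*} [NormedAddCommGroup H] [InnerProductSpace ℝ H] [CompleteSpace H]
  [SecondCountableTopology H]

theorem add_nat_mul_period_eq {E : Type*} {ω : ℝ} {Y : ℝ → E} (hω : 0 ≤ ω)
    (hY : ∀ t ≥ (0 : ℝ), Y (t + ω) = Y t)
    {t : ℝ} (ht : 0 ≤ t) (k : ℕ) : Y (t + k * ω) = Y t := by
  induction k with
  | zero => simp
  | succ k ih =>
    rw [← ih, ← hY (t + k * ω) (by positivity)]
    congr 1
    push_cast
    ring

section ShiftLimit

variable {E : Type*} [NormedAddCommGroup E] {ω : ℝ} {X Y : ℝ → E}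

/-- A pointwise limit of the shifts `t ↦ X (t + n * ω)` on `[0, ∞)` is `ω`-periodic there. -/
theorem add_period_eq_of_tendsto_shift (hω : 0 ≤ ω)
    (h : ∀ t ≥ (0 : ℝ), Tendsto (fun n : ℕ => X (t + n * ω)) atTop (𝓝 (Y t)))
    {t : ℝ} (ht : 0 ≤ t) : Y (t + ω) = Y t := by
  refine tendsto_nhds_unique (h (t + ω) (by positivity)) ?_
  convert (h t ht).comp (tendsto_add_atTop_nat 1) using 2 with n
  simp only [Function.comp_apply]
  congr 1
  push_cast
  ring

/-- Uniform convergence of the shifts over one period of the limit is uniform on `[0, ∞)`. -/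
theorem tendstoUniformlyOn_shift_Ici (hω : 0 < ω) (hY : ∀ t ≥ (0 : ℝ), Y (t + ω) = Y t)
    (h : TendstoUniformlyOn (fun (n : ℕ) t => X (t + n * ω)) Y atTop (Set.Icc 0 ω)) :
    TendstoUniformlyOn (fun (n : ℕ) t => X (t + n * ω)) Y atTop (Set.Ici 0) := by
  rw [Metric.tendstoUniformlyOn_iff] at h ⊢
  intro ε hε
  obtain ⟨N, hN⟩ := eventually_atTop.1 (h ε hε)
  refine eventually_atTop.2 ⟨N, fun n hn t ht => ?_⟩
  have ht' : (0 : ℝ) ≤ t := ht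
  set k := ⌊t / ω⌋₊
  have hk : k * ω ≤ t := (le_div_iff₀ hω).1 (Nat.floor_le (by positivity))
  have hk' : t < (k + 1) * ω := (div_lt_iff₀ hω).1 (Nat.lt_floor_add_one _)
  have hs : (0 : ℝ) ≤ t - k * ω := by linarith
  have key := hN (n + k) (by omega) (t - k * ω) ⟨hs, by linarith⟩
  rw [← add_nat_mul_period_eq hω.le hY hs k, sub_add_cancel] at key
  convert key using 3
  push_cast
  ring

end ShiftLimit

/-- if `X` is a continuous bounded process and `Y : [0,∞) → L²(ℙ,H)`
satisfies `E‖X(t+nω) − Y(t)‖² → 0` for every `t ≥ 0`, the convergence being uniform for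
`t ∈ [0,ω]`, then `Y` is bounded, `Y` is continuous on `[0,∞)`, and
`E‖Y(t+ω) − Y(t)‖² = 0` for every `t ≥ 0`. -/
theorem limit_bounded_continuous_periodic (ω : ℝ) (hω : 0 < ω)
    (X : ℝ → Lp H 2 P)
    (hXc : ContinuousOn X (Set.Ici 0)) (hXb : ∃ K > 0, ∀ t ≥ (0:ℝ), ‖X t‖ ^ 2 ≤ K)
    (Y : ℝ → Lp H 2 P)
    (hpt : ∀ t ≥ (0:ℝ), Tendsto (fun n : ℕ => ‖X (t + n * ω) - Y t‖ ^ 2) atTop (𝓝 0))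
    (hunif : ∀ ε > (0:ℝ), ∃ N : ℕ, ∀ n ≥ N, ∀ t ∈ Set.Icc (0:ℝ) ω,
      ‖X (t + n * ω) - Y t‖ ^ 2 < ε) :
    (∃ K > 0, ∀ t ≥ (0:ℝ), ‖Y t‖ ^ 2 ≤ K) ∧
    ContinuousOn Y (Set.Ici 0) ∧
    ∀ t ≥ (0:ℝ), ‖Y (t + ω) - Y t‖ ^ 2 = 0 := by
  have hlim : ∀ t ≥ (0:ℝ), Tendsto (fun n : ℕ => X (t + n * ω)) atTop (𝓝 (Y t)) := by
    intro t ht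
    rw [tendsto_iff_norm_sub_tendsto_zero]
    simpa [Real.sqrt_sq] using (hpt t ht).sqrt
  have hper : ∀ t ≥ (0:ℝ), Y (t + ω) = Y t := fun t ht =>
    add_period_eq_of_tendsto_shift hω.le hlim ht
  have hIcc : TendstoUniformlyOn (fun (n : ℕ) t => X (t + n * ω)) Y atTop (Set.Icc 0 ω) := by
    rw [Metric.tendstoUniformlyOn_iff]
    intro ε hε
    obtain ⟨N, hN⟩ := hunif (ε ^ 2) (by positivity)
    refine eventually_atTop.2 ⟨N, fun n hn t ht => ?_⟩
    rw [dist_comm, dist_eq_norm]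
    exact lt_of_pow_lt_pow_left₀ 2 hε.le (hN n hn t ht)
  refine ⟨?_, ?_, fun t ht => by simp [hper t ht]⟩
  · obtain ⟨K, hK, hX⟩ := hXb
    refine ⟨K, hK, fun t ht => ?_⟩
    exact le_of_tendsto ((hlim t ht).norm.pow 2)
      (Eventually.of_forall fun n => hX _ (by positivity))
  · refine (tendstoUniformlyOn_shift_Ici hω hper hIcc).continuousOn
      (Frequently.of_forall fun n => ?_)
    refine hXc.comp (by fun_prop) fun t ht => ?_
    have ht' : (0 : ℝ) ≤ t := ht
    exact Set.mem_Ici.2 (by positivity)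
end

section
/- Let X be a continuous bounded process, ω > 0, and Y : [0,∞) → L²(ℙ,H) a bounded process with E‖Y(t+ω) − Y(t)‖² = 0 for every t ≥ 0, such that E‖X(t+nω) − Y(t)‖² → 0 as n → ∞ uniformly for t ∈ [0,ω]. Then lim_{t→∞} E‖X(t) − Y(t)‖² = 0. -/
open MeasureTheory Filter Topology

variable {Ω : Type*} [MeasurableSpace Ω] (P : Measure Ω) [IsProbabilityMeasure P]
  {H : Type*} [NormedAddCommGroup H] [InnerProductSpace ℝ H] [CompleteSpace H]
  [SecondCountableTopology H]

/-- if `X` is a continuous bounded process and `Y : [0,∞) → L²(ℙ,H)` is a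
bounded process with `E‖Y(t+ω) − Y(t)‖² = 0` for every `t ≥ 0` such that
`E‖X(t+nω) − Y(t)‖² → 0` as `n → ∞` uniformly for `t ∈ [0,ω]`, then
`E‖X(t) − Y(t)‖² → 0` as `t → ∞`. -/
theorem diff_tendsto_zero (ω : ℝ) (hω : 0 < ω)
    (X : ℝ → Lp H 2 P)
    (hXc : ContinuousOn X (Set.Ici 0)) (hXb : ∃ K > 0, ∀ t ≥ (0:ℝ), ‖X t‖ ^ 2 ≤ K)
    (Y : ℝ → Lp H 2 P)
    (hYb : ∃ K > 0, ∀ t ≥ (0:ℝ), ‖Y t‖ ^ 2 ≤ K)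
    (hYper : ∀ t ≥ (0:ℝ), ‖Y (t + ω) - Y t‖ ^ 2 = 0)
    (hunif : ∀ ε > (0:ℝ), ∃ N : ℕ, ∀ n ≥ N, ∀ t ∈ Set.Icc (0:ℝ) ω,
      ‖X (t + n * ω) - Y t‖ ^ 2 < ε) :
    Tendsto (fun t : ℝ => ‖X t - Y t‖ ^ 2) atTop (𝓝 0) := by
  have hper : ∀ (n : ℕ) (t : ℝ), 0 ≤ t → Y (t + n * ω) = Y t := by
    intro n t ht
    induction n with
    | zero => simp
    | succ k ih =>
      have h := hYper (t + k * ω) (by positivity)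
      rw [sq_eq_zero_iff, norm_eq_zero, sub_eq_zero] at h
      rw [← ih, ← h]
      congr 1
      push_cast
      ring
  rw [Metric.tendsto_atTop]
  intro ε hε
  obtain ⟨N, hN⟩ := hunif ε hε
  refine ⟨N * ω, fun t ht => ?_⟩
  have ht0 : 0 ≤ t := le_trans (by positivity) ht
  set n := ⌊t / ω⌋₊
  have hNn : N ≤ n := Nat.le_floor ((le_div_iff₀ hω).2 ht)
  have h1 : (n : ℝ) * ω ≤ t := (le_div_iff₀ hω).1 (Nat.floor_le (by positivity))
  have h2 : t < ((n : ℝ) + 1) * ω := (div_lt_iff₀ hω).1 (Nat.lt_floor_add_one _)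
  have h := hN n hNn (t - n * ω) ⟨by linarith, by linarith⟩
  rw [← hper n (t - n * ω) (by linarith), sub_add_cancel] at h
  rwa [Real.dist_eq, sub_zero, abs_of_nonneg (by positivity)]
end

section
/- Composition theorem: let f : [0,∞) × L²(ℙ,H) → L²(ℙ,H) be continuous and satisfy (a) for every bounded set K ⊆ L²(ℙ,H) the set {f(t,x) : t ≥ 0, x ∈ K} is bounded; (b) there is a map f̃ : [0,∞) × L²(ℙ,H) → L²(ℙ,H) with E‖f(t+nω, x) − f̃(t,x)‖² → 0 as n → ∞ for every t ≥ 0 and every x in any bounded set; (c) there is a constant L > 0 with E‖f(t,x) − f(t,y)‖² ≤ L·E‖x − y‖² for all t ≥ 0 and all x, y ∈ L²(ℙ,H). If X is a square-mean ω-periodic limit process with limit process X̃, then F(t) = f(t, X(t)) is a square-mean ω-periodic limit process with limit process F̃(t) = f̃(t, X̃(t)). -/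
open MeasureTheory Filter Topology

variable {Ω : Type*} [MeasurableSpace Ω] (P : Measure Ω) [IsProbabilityMeasure P]
  {H : Type*} [NormedAddCommGroup H] [InnerProductSpace ℝ H] [CompleteSpace H]
  [SecondCountableTopology H]

/-- composition theorem: let `f : [0,∞) × L²(ℙ,H) → L²(ℙ,H)` be
continuous, bounded on bounded sets, a square-mean `ω`-periodic limit map (with limit
map `ft`) pointwise in `t` for each `x`, and Lipschitz in the square mean uniformly in
`t`. If `X` is a square-mean `ω`-periodic limit process with limit process `Xt`, then
`F(t) = f(t, X(t))` is a square-mean `ω`-periodic limit process with limit process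
`Ft(t) = ft(t, Xt(t))`. -/
theorem composition_isPeriodicLimit (ω : ℝ) (hω : 0 < ω)
    (f ft : ℝ → Lp H 2 P → Lp H 2 P)
    (hfc : ContinuousOn (fun q : ℝ × Lp H 2 P => f q.1 q.2) (Set.Ici 0 ×ˢ Set.univ))
    (hfbdd : ∀ K : Set (Lp H 2 P), Bornology.IsBounded K →
      ∃ C : ℝ, ∀ t ≥ (0:ℝ), ∀ x ∈ K, ‖f t x‖ ^ 2 ≤ C)
    (hflim : ∀ t ≥ (0:ℝ), ∀ x : Lp H 2 P,
      Tendsto (fun n : ℕ => ‖f (t + n * ω) x - ft t x‖ ^ 2) atTop (𝓝 0))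
    (L : ℝ) (hL : 0 < L)
    (hlip : ∀ t ≥ (0:ℝ), ∀ x y : Lp H 2 P, ‖f t x - f t y‖ ^ 2 ≤ L * ‖x - y‖ ^ 2)
    (X Xt : ℝ → Lp H 2 P) (hX : IsPeriodicLimit P ω X Xt) :
    IsPeriodicLimit P ω (fun t => f t (X t)) (fun t => ft t (Xt t)) := by
  obtain ⟨hXc, ⟨K, -, hK⟩, hXlim⟩ := hX
  refine ⟨?_, ?_, fun t ht => ?_⟩
  · exact hfc.comp (continuousOn_id.prodMk hXc) fun t ht => ⟨ht, Set.mem_univ _⟩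
  · have hbdd : Bornology.IsBounded (X '' Set.Ici 0) := by
      refine isBounded_iff_forall_norm_le.2 ⟨√K, ?_⟩
      rintro _ ⟨t, ht, rfl⟩
      exact Real.le_sqrt_of_sq_le (hK t ht)
    obtain ⟨C, hC⟩ := hfbdd _ hbdd
    exact ⟨max C 1, by positivity, fun t ht =>
      (hC t ht _ (Set.mem_image_of_mem X ht)).trans (le_max_left _ _)⟩
  · have hlim : Tendsto (fun n : ℕ => 2 * (L * ‖X (t + n * ω) - Xt t‖ ^ 2
        + ‖f (t + n * ω) (Xt t) - ft t (Xt t)‖ ^ 2)) atTop (𝓝 0) := by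
      simpa using (((hXlim t ht).const_mul L).add (hflim t ht (Xt t))).const_mul 2
    refine squeeze_zero (fun n => sq_nonneg _) (fun n => ?_) hlim
    have hn : 0 ≤ t + n * ω := by positivity
    calc ‖f (t + n * ω) (X (t + n * ω)) - ft t (Xt t)‖ ^ 2
        ≤ (‖f (t + n * ω) (X (t + n * ω)) - f (t + n * ω) (Xt t)‖
          + ‖f (t + n * ω) (Xt t) - ft t (Xt t)‖) ^ 2 := by
          gcongr
          exact norm_sub_le_norm_sub_add_norm_sub _ _ _
      _ ≤ 2 * (‖f (t + n * ω) (X (t + n * ω)) - f (t + n * ω) (Xt t)‖ ^ 2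
          + ‖f (t + n * ω) (Xt t) - ft t (Xt t)‖ ^ 2) := add_sq_le
      _ ≤ _ := by
          gcongr
          exact hlip _ hn _ _
end

section
/- Let F be a square-mean ω-periodic limit process. Define X_n(t) = ∫₀^{nω} T(t+s) F(nω − s) ds (a Bochner integral in L²(ℙ,H)). Then for every t ≥ 0, the sequence (X_n(t))_{n≥1} is a Cauchy sequence in L²(ℙ,H); in particular it converges to a limit U(t) ∈ L²(ℙ,H). -/
open MeasureTheory Filter Topology

/-- Norm-bounded operators converging at the limit of a convergent net of vectors converge along
that net. -/
theorem tendsto_clm_apply_of_norm_le {ι E G : Type*} [NormedAddCommGroup E] [NormedSpace ℝ E]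
    [NormedAddCommGroup G] [NormedSpace ℝ G] {l : Filter ι} {A : ι → E →L[ℝ] G} {x : ι → E}
    {x₀ : E} {y : G} {C : ℝ} (hC : ∀ᶠ i in l, ‖A i‖ ≤ C)
    (hA : Tendsto (fun i => A i x₀) l (𝓝 y)) (hx : Tendsto x l (𝓝 x₀)) :
    Tendsto (fun i => A i (x i)) l (𝓝 y) := by
  have hdiff : Tendsto (fun i => A i (x i - x₀)) l (𝓝 0) := by
    refine squeeze_zero_norm' (a := fun i => C * ‖x i - x₀‖) ?_ ?_
    · filter_upwards [hC] with i hi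
      exact (A i).le_of_opNorm_le hi _
    · simpa using (tendsto_iff_norm_sub_tendsto_zero.mp hx).const_mul C
  simpa using hdiff.add hA

/-- Along `F (n * ω - s)`, convergence of all the sequences `F (r + n * ω)` with `r ≥ 0` gives
convergence for every real `s`. -/
theorem exists_tendsto_comp_natCast_mul_sub {E : Type*} [TopologicalSpace E] {ω : ℝ} (hω : 0 < ω)
    {F Ft : ℝ → E}
    (hF : ∀ r ≥ (0 : ℝ), Tendsto (fun n : ℕ => F (r + n * ω)) atTop (𝓝 (Ft r))) (s : ℝ) :
    ∃ y, Tendsto (fun n : ℕ => F (n * ω - s)) atTop (𝓝 y) := by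
  obtain ⟨k, hk⟩ := exists_nat_ge (s / ω)
  refine ⟨Ft (k * ω - s), ?_⟩
  rw [← tendsto_add_atTop_iff_nat k]
  refine (hF (k * ω - s) (sub_nonneg.mpr ((div_le_iff₀ hω).mp hk))).congr fun n => ?_
  congr 1
  push_cast
  ring

/-- The convolution integrals `∫₀^{nω} T(t+s) F(nω - s) ds` of an exponentially decaying strongly
continuous family with a bounded continuous function all of whose `ω`-translates converge
pointwise are convergent. -/
theorem exists_tendsto_integral_clm_apply {E : Type*} [NormedAddCommGroup E] [NormedSpace ℝ E]
    {ω : ℝ} (hω : 0 < ω) {T : ℝ → E →L[ℝ] E}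
    (hTcont : ∀ x : E, ContinuousOn (fun t => T t x) (Set.Ici 0))
    {M a : ℝ} (hM : 0 ≤ M) (ha : 0 < a)
    (hTnorm : ∀ t ≥ (0 : ℝ), ‖T t‖ ≤ M * Real.exp (-a * t))
    {F Ft : ℝ → E} (hFcont : ContinuousOn F (Set.Ici 0)) {C : ℝ}
    (hFC : ∀ t ≥ (0 : ℝ), ‖F t‖ ≤ C)
    (hF : ∀ r ≥ (0 : ℝ), Tendsto (fun n : ℕ => F (r + n * ω)) atTop (𝓝 (Ft r)))
    {t : ℝ} (ht : 0 ≤ t) :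
    ∃ U : E, Tendsto (fun n : ℕ => ∫ s in (0 : ℝ)..(n * ω), T (t + s) (F (n * ω - s)))
      atTop (𝓝 U) := by
  have hC : 0 ≤ C := (norm_nonneg _).trans (hFC 0 le_rfl)
  have hT : ∀ s ≥ (0 : ℝ), ‖T s‖ ≤ M := fun s hs =>
    (hTnorm s hs).trans (mul_le_of_le_one_right hM (Real.exp_le_one_iff.mpr (by nlinarith)))
  have hcont : ∀ n : ℕ,
      ContinuousOn (fun s => T (t + s) (F (n * ω - s))) (Set.Icc 0 (n * ω)) := by
    intro n s hs
    refine tendsto_clm_apply_of_norm_le (x₀ := F (n * ω - s)) (C := M) ?_ ?_ ?_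
    · filter_upwards [self_mem_nhdsWithin] with r hr
      exact hT _ (add_nonneg ht hr.1)
    · exact ((hTcont (F (n * ω - s))).comp (f := fun r => t + r) (by fun_prop)
        (fun r hr => add_nonneg ht hr.1)) s hs
    · exact (hFcont.comp (f := fun r => n * ω - r) (by fun_prop)
        (fun r hr => sub_nonneg.mpr hr.2)) s hs
  choose y hy using exists_tendsto_comp_natCast_mul_sub hω hF
  refine ⟨∫ s in Set.Ioi (0 : ℝ), T (t + s) (y s), ?_⟩
  have hrepr : ∀ n : ℕ, ∫ s in (0 : ℝ)..(n * ω), T (t + s) (F (n * ω - s)) =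
      ∫ s in Set.Ioi (0 : ℝ),
        (Set.Ioc 0 (n * ω)).indicator (fun s => T (t + s) (F (n * ω - s))) s := by
    intro n
    rw [intervalIntegral.integral_of_le (by positivity),
      setIntegral_indicator measurableSet_Ioc,
      Set.inter_eq_self_of_subset_right Set.Ioc_subset_Ioi_self]
  simp_rw [hrepr]
  refine tendsto_integral_of_dominated_convergence
    (fun s => M * C * Real.exp (-a * s)) (fun n => ?_) ?_ (fun n => ?_) ?_
  · refine AEStronglyMeasurable.mono_measure ?_ Measure.restrict_le_self
    exact (aestronglyMeasurable_indicator_iff measurableSet_Ioc).mpr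
      (((hcont n).mono Set.Ioc_subset_Icc_self).aestronglyMeasurable measurableSet_Ioc)
  · exact (integrableOn_exp_mul_Ioi (neg_neg_of_pos ha) 0).const_mul _
  · refine ae_restrict_of_forall_mem measurableSet_Ioi fun s hs => ?_
    have hs : 0 < s := hs
    by_cases hmem : s ∈ Set.Ioc 0 (n * ω)
    · rw [Set.indicator_of_mem hmem]
      have hexp : Real.exp (-a * (t + s)) ≤ Real.exp (-a * s) :=
        Real.exp_le_exp.mpr (by nlinarith)
      calc ‖T (t + s) (F (n * ω - s))‖
          ≤ (M * Real.exp (-a * (t + s))) * C :=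
            (T (t + s)).le_of_opNorm_le_of_le (hTnorm _ (by positivity))
              (hFC _ (sub_nonneg.mpr hmem.2))
        _ ≤ (M * Real.exp (-a * s)) * C := by gcongr
        _ = M * C * Real.exp (-a * s) := by ring
    · rw [Set.indicator_of_notMem hmem, norm_zero]
      positivity
  · refine ae_restrict_of_forall_mem measurableSet_Ioi fun s hs => ?_
    refine (((T (t + s)).continuous.tendsto (y s)).comp (hy s)).congr' ?_
    filter_upwards [(tendsto_natCast_atTop_atTop.atTop_mul_const hω).eventually_ge_atTop s]
      with n hn
    have hmem : s ∈ Set.Ioc 0 (n * ω) := ⟨hs, hn⟩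
    rw [Set.indicator_of_mem hmem, Function.comp_apply]

variable {Ω : Type*} [MeasurableSpace Ω] (P : Measure Ω) [IsProbabilityMeasure P]
  {H : Type*} [NormedAddCommGroup H] [InnerProductSpace ℝ H] [CompleteSpace H]
  [SecondCountableTopology H]

/-- if `F` is a square-mean `ω`-periodic limit process and `(T(t))` is an
exponentially stable semigroup on `L²(ℙ,H)`, then for every `t ≥ 0` the sequence
`X_n(t) = ∫₀^{nω} T(t+s) F(nω − s) ds` (a Bochner integral) is Cauchy in `L²(ℙ,H)`; in
particular it converges to some `U(t) ∈ L²(ℙ,H)`. -/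
theorem integral_cauchySeq (ω : ℝ) (hω : 0 < ω)
    (T : ℝ → Lp H 2 P →L[ℝ] Lp H 2 P)
    (hT0 : T 0 = ContinuousLinearMap.id ℝ (Lp H 2 P))
    (hTsem : ∀ t ≥ (0:ℝ), ∀ r ≥ (0:ℝ), T (t + r) = (T t).comp (T r))
    (hTcont : ∀ x : Lp H 2 P, ContinuousOn (fun t => T t x) (Set.Ici 0))
    (M a : ℝ) (hM : 0 < M) (ha : 0 < a)
    (hTnorm : ∀ t ≥ (0:ℝ), ‖T t‖ ≤ M * Real.exp (-a * t))
    (F Ft : ℝ → Lp H 2 P) (hF : IsPeriodicLimit P ω F Ft) :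
    ∀ t ≥ (0:ℝ),
      CauchySeq (fun n : ℕ => ∫ s in (0:ℝ)..(n * ω), T (t + s) (F (n * ω - s))) ∧
      ∃ U : Lp H 2 P,
        Tendsto (fun n : ℕ => ∫ s in (0:ℝ)..(n * ω), T (t + s) (F (n * ω - s)))
          atTop (𝓝 U) := by
  intro t ht
  obtain ⟨hFcont, ⟨K, -, hK⟩, hlim⟩ := hF
  have hFlim : ∀ r ≥ (0 : ℝ), Tendsto (fun n : ℕ => F (r + n * ω)) atTop (𝓝 (Ft r)) := by
    intro r hr
    rw [tendsto_iff_norm_sub_tendsto_zero]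
    simpa using (hlim r hr).sqrt
  obtain ⟨U, hU⟩ := exists_tendsto_integral_clm_apply hω hTcont hM.le ha hTnorm hFcont
    (fun r hr => Real.le_sqrt_of_sq_le (hK r hr)) hFlim ht
  exact ⟨hU.cauchySeq, U, hU⟩
end

section
/- Let F be a square-mean ω-periodic limit process with limit process F̃, and let U(t) = lim_{n→∞} ∫₀^{nω} T(t+s) F(nω − s) ds (this limit exists in L²(ℙ,H)). Define V(t) = ∫₀^{t} T(t−s) F(s) ds and V*(t) = U(t) + ∫₀^{t} T(t−s) F̃(s) ds. Then lim_{n→∞} E‖V(t+nω) − V*(t)‖² = 0 uniformly in t ≥ 0. -/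
open MeasureTheory Filter Topology

/-- Discrete Gronwall-type bound for the convolution of `exp (-a ·)` with a function whose
translates by `ω` have small integrals over one period. -/
lemma integral_exp_mul_le_of_shift {a ω : ℝ} (ha : 0 < a) (hω : 0 < ω) {g : ℕ → ℝ → ℝ} {δ : ℝ}
    (hδ : 0 ≤ δ) (hg0 : ∀ n s, 0 ≤ g n s)
    (hgi : ∀ n, ∀ t ≥ (0:ℝ), IntervalIntegrable (g n) volume 0 t)
    (hshift : ∀ n, ∀ s ≥ (0:ℝ), g n (s + ω) = g (n + 1) s) (k : ℕ) :
    ∀ n, (∀ m ≥ n, ∫ s in (0:ℝ)..ω, g m s ≤ δ) → ∀ t ≥ (0:ℝ), t ≤ (k + 1) * ω →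
      ∫ s in (0:ℝ)..t, Real.exp (-a * (t - s)) * g n s ≤
        δ * (1 + (1 - Real.exp (-a * ω))⁻¹ * (1 - Real.exp (-a * t))) := by
  have hq : Real.exp (-a * ω) < 1 := by
    rw [Real.exp_lt_one_iff]; nlinarith
  have hc : 0 < (1 - Real.exp (-a * ω))⁻¹ := inv_pos.2 (by linarith)
  have hcq : (1 - Real.exp (-a * ω))⁻¹ * (1 - Real.exp (-a * ω)) = 1 :=
    inv_mul_cancel₀ (by linarith)
  have hint : ∀ n, ∀ t ≥ (0:ℝ), ∀ r,
      IntervalIntegrable (fun s => Real.exp (-a * (r - s)) * g n s) volume 0 t :=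
    fun n t ht r => (hgi n t ht).continuousOn_mul (by fun_prop)
  have hshort : ∀ n, (∀ m ≥ n, ∫ s in (0:ℝ)..ω, g m s ≤ δ) → ∀ t ≥ (0:ℝ), t ≤ ω →
      ∫ s in (0:ℝ)..t, Real.exp (-a * (t - s)) * g n s ≤ δ := by
    intro n hn t ht htω
    calc ∫ s in (0:ℝ)..t, Real.exp (-a * (t - s)) * g n s
        ≤ ∫ s in (0:ℝ)..t, g n s := by
          refine intervalIntegral.integral_mono_on ht (hint n t ht t) (hgi n t ht) ?_
          intro s hs
          refine mul_le_of_le_one_left (hg0 n s) (Real.exp_le_one_iff.2 ?_)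
          nlinarith [hs.2]
      _ ≤ ∫ s in (0:ℝ)..ω, g n s :=
          intervalIntegral.integral_mono_interval le_rfl ht htω
            (Eventually.of_forall (hg0 n)) (hgi n ω hω.le)
      _ ≤ δ := hn n le_rfl
  have hbase : ∀ n, (∀ m ≥ n, ∫ s in (0:ℝ)..ω, g m s ≤ δ) → ∀ t ≥ (0:ℝ), t ≤ ω →
      ∫ s in (0:ℝ)..t, Real.exp (-a * (t - s)) * g n s ≤
        δ * (1 + (1 - Real.exp (-a * ω))⁻¹ * (1 - Real.exp (-a * t))) := by
    intro n hn t ht htω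
    refine (hshort n hn t ht htω).trans (le_mul_of_one_le_right hδ ?_)
    have : Real.exp (-a * t) ≤ 1 := Real.exp_le_one_iff.2 (by nlinarith)
    have := mul_nonneg hc.le (sub_nonneg.2 this)
    linarith
  induction k with
  | zero => intro n hn t ht htk; exact hbase n hn t ht (by simpa using htk)
  | succ k ih =>
    intro n hn t ht htk
    rcases le_total t ω with htω | htω
    · exact hbase n hn t ht htω
    have hsplit := intervalIntegral.integral_add_adjacent_intervals (hint n ω hω.le t)
      ((hint n ω hω.le t).symm.trans (hint n t ht t))
    have hfirst : ∫ s in (0:ℝ)..ω, Real.exp (-a * (t - s)) * g n s ≤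
        Real.exp (-a * (t - ω)) * δ := by
      have heq : ∫ s in (0:ℝ)..ω, Real.exp (-a * (t - s)) * g n s =
          Real.exp (-a * (t - ω)) * ∫ s in (0:ℝ)..ω, Real.exp (-a * (ω - s)) * g n s := by
        rw [← intervalIntegral.integral_const_mul]
        refine intervalIntegral.integral_congr fun s _ => ?_
        rw [← mul_assoc, ← Real.exp_add]
        ring_nf
      rw [heq]
      exact mul_le_mul_of_nonneg_left (hshort n hn ω hω.le le_rfl) (Real.exp_pos _).le
    have hsecond : ∫ s in ω..t, Real.exp (-a * (t - s)) * g n s =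
        ∫ s in (0:ℝ)..(t - ω), Real.exp (-a * (t - ω - s)) * g (n + 1) s := by
      have h := intervalIntegral.integral_comp_add_right (a := 0) (b := t - ω)
        (fun s => Real.exp (-a * (t - s)) * g n s) ω
      rw [zero_add, sub_add_cancel] at h
      rw [← h]
      refine intervalIntegral.integral_congr fun s hs => ?_
      rw [Set.uIcc_of_le (by linarith)] at hs
      rw [hshift n s hs.1]
      ring_nf
    have hih := ih (n + 1) (fun m hm => hn m (by omega)) (t - ω) (by linarith)
      (by push_cast at htk; linarith)
    have hexp : Real.exp (-a * t) = Real.exp (-a * (t - ω)) * Real.exp (-a * ω) := by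
      rw [← Real.exp_add]; ring_nf
    rw [← hsplit, hsecond, hexp]
    refine (add_le_add hfirst hih).trans (le_of_eq ?_)
    linear_combination (δ * Real.exp (-a * (t - ω))) * (-hcq)

section StronglyContinuous

variable {E : Type*} [NormedAddCommGroup E] [NormedSpace ℝ E]

/-- A uniformly bounded strongly continuous family of operators acts jointly continuously. -/
lemma continuousOn_clm_apply_of_bounded {T : ℝ → E →L[ℝ] E}
    (hTcont : ∀ x, ContinuousOn (fun t => T t x) (Set.Ici 0)) {M : ℝ}
    (hTM : ∀ t ≥ (0:ℝ), ‖T t‖ ≤ M) {S : Set ℝ} {u : ℝ → ℝ} {f : ℝ → E}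
    (hu : ContinuousOn u S) (huS : ∀ s ∈ S, 0 ≤ u s) (hf : ContinuousOn f S) :
    ContinuousOn (fun s => T (u s) (f s)) S := by
  intro s₀ hs₀
  have h1 : Tendsto (fun s => T (u s) (f s - f s₀)) (𝓝[S] s₀) (𝓝 0) := by
    have hlim : Tendsto (fun s => M * ‖f s - f s₀‖) (𝓝[S] s₀) (𝓝 0) := by
      have := ((hf s₀ hs₀).tendsto.sub_const (f s₀)).norm.const_mul M
      simpa using this
    refine squeeze_zero_norm' ?_ hlim
    filter_upwards [self_mem_nhdsWithin] with s hs
    exact (T (u s)).le_of_opNorm_le (hTM _ (huS s hs)) _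
  have h2 : Tendsto (fun s => T (u s) (f s₀)) (𝓝[S] s₀) (𝓝 (T (u s₀) (f s₀))) :=
    ((hTcont (f s₀)).comp hu huS) s₀ hs₀
  have h3 := h1.add h2
  simpa [ContinuousWithinAt] using h3

variable [CompleteSpace E]

/-- Uniform convergence of the translated convolutions of an exponentially stable semigroup with
a bounded continuous function having an `ω`-periodic limit. -/
theorem convolution_periodic_limit {ω : ℝ} (hω : 0 < ω) {T : ℝ → E →L[ℝ] E}
    (hT0 : T 0 = ContinuousLinearMap.id ℝ E)
    (hTsem : ∀ t ≥ (0:ℝ), ∀ r ≥ (0:ℝ), T (t + r) = (T t).comp (T r))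
    (hTcont : ∀ x : E, ContinuousOn (fun t => T t x) (Set.Ici 0))
    {M a : ℝ} (hM : 0 < M) (ha : 0 < a)
    (hTnorm : ∀ t ≥ (0:ℝ), ‖T t‖ ≤ M * Real.exp (-a * t))
    {F Ft : ℝ → E} (hFc : ContinuousOn F (Set.Ici 0)) {B : ℝ} (hFB : ∀ t ≥ (0:ℝ), ‖F t‖ ≤ B)
    (hFt : ∀ t ≥ (0:ℝ), Tendsto (fun n : ℕ => F (t + n * ω)) atTop (𝓝 (Ft t)))
    {U : ℝ → E}
    (hU : ∀ t ≥ (0:ℝ),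
      Tendsto (fun n : ℕ => ∫ s in (0:ℝ)..(n * ω), T (t + s) (F (n * ω - s)))
        atTop (𝓝 (U t))) {ε : ℝ} (hε : 0 < ε) :
    ∃ N : ℕ, ∀ n ≥ N, ∀ t ≥ (0:ℝ),
      ‖(∫ s in (0:ℝ)..(t + n * ω), T (t + n * ω - s) (F s)) -
        (U t + ∫ s in (0:ℝ)..t, T (t - s) (Ft s))‖ < ε := by
  have hTM : ∀ t ≥ (0:ℝ), ‖T t‖ ≤ M := fun t ht =>
    (hTnorm t ht).trans (mul_le_of_le_one_right hM.le (Real.exp_le_one_iff.2 (by nlinarith)))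
  have hnω : ∀ n : ℕ, 0 ≤ (n : ℝ) * ω := fun n => by positivity
  have hFtB : ∀ t ≥ (0:ℝ), ‖Ft t‖ ≤ B := fun t ht =>
    le_of_tendsto (hFt t ht).norm
      (Eventually.of_forall fun n => hFB _ (add_nonneg ht (hnω n)))
  have hFtper : ∀ t ≥ (0:ℝ), Ft (t + ω) = Ft t := by
    intro t ht
    refine tendsto_nhds_unique (hFt (t + ω) (by linarith)) ?_
    refine ((hFt t ht).comp (tendsto_add_atTop_nat 1)).congr fun n => ?_
    simp only [Function.comp_apply]
    congr 1
    push_cast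
    ring
  have hFshift : ∀ (n : ℕ), ContinuousOn (fun s => F (s + n * ω)) (Set.Ici 0) := fun n =>
    hFc.comp (by fun_prop) fun s hs => add_nonneg hs (hnω n)
  have hsub : ∀ {t : ℝ}, 0 ≤ t → Set.uIcc 0 t ⊆ Set.Ici 0 := fun ht s hs => by
    rw [Set.uIcc_of_le ht] at hs; exact hs.1
  have hTFc : ∀ n : ℕ, ∀ t ≥ (0:ℝ), ContinuousOn (fun s => T (t - s) (F (s + n * ω)))
      (Set.uIcc 0 t) := fun n t ht =>
    continuousOn_clm_apply_of_bounded hTcont hTM (by fun_prop)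
      (fun s hs => by rw [Set.uIcc_of_le ht] at hs; linarith [hs.2])
      ((hFshift n).mono (hsub ht))
  have hTFc0 : ∀ t ≥ (0:ℝ), ContinuousOn (fun s => T (t - s) (F s)) (Set.uIcc 0 t) :=
    fun t ht => by simpa using hTFc 0 t ht
  have hIoc : ∀ {t : ℝ}, 0 ≤ t → ∀ᵐ s ∂(volume.restrict (Set.uIoc 0 t)), 0 < s ∧ s ≤ t :=
    fun ht => by
      rw [Set.uIoc_of_le ht]
      exact ae_restrict_mem measurableSet_Ioc
  have hmeas : ∀ {t : ℝ}, 0 ≤ t → ∀ {f : ℝ → E}, ContinuousOn f (Set.uIcc 0 t) →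
      AEStronglyMeasurable f (volume.restrict (Set.uIoc 0 t)) := fun ht f hf =>
    (hf.mono Set.uIoc_subset_uIcc).aestronglyMeasurable measurableSet_uIoc
  have hFtm : ∀ t ≥ (0:ℝ), AEStronglyMeasurable Ft (volume.restrict (Set.uIoc 0 t)) := by
    intro t ht
    refine aestronglyMeasurable_of_tendsto_ae atTop
      (fun n : ℕ => hmeas ht ((hFshift n).mono (hsub ht))) ?_
    filter_upwards [hIoc ht] with s hs using hFt s hs.1.le
  have hTFtm : ∀ t ≥ (0:ℝ), AEStronglyMeasurable (fun s => T (t - s) (Ft s))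
      (volume.restrict (Set.uIoc 0 t)) := by
    intro t ht
    refine aestronglyMeasurable_of_tendsto_ae atTop (fun n : ℕ => hmeas ht (hTFc n t ht)) ?_
    filter_upwards [hIoc ht] with s hs
    exact ((T (t - s)).continuous.tendsto _).comp (hFt s hs.1.le)
  have hTFti : ∀ t ≥ (0:ℝ), IntervalIntegrable (fun s => T (t - s) (Ft s)) volume 0 t := by
    intro t ht
    refine (intervalIntegrable_const (c := M * B)).mono_fun' (hTFtm t ht) ?_
    filter_upwards [hIoc ht] with s hs
    exact (T (t - s)).le_of_opNorm_le_of_le (hTM _ (by linarith [hs.2])) (hFtB s hs.1.le)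
  -- the one-period error
  set g : ℕ → ℝ → ℝ := fun n s => ‖F (s + n * ω) - Ft s‖ with hg
  have hgm : ∀ n, ∀ t ≥ (0:ℝ), AEStronglyMeasurable (g n) (volume.restrict (Set.uIoc 0 t)) :=
    fun n t ht => ((hmeas ht ((hFshift n).mono (hsub ht))).sub (hFtm t ht)).norm
  have hgB : ∀ n, ∀ s ≥ (0:ℝ), ‖g n s‖ ≤ B + B := fun n s hs => by
    rw [hg, norm_norm]
    exact norm_sub_le_of_le (hFB _ (add_nonneg hs (hnω n))) (hFtB s hs)
  have hgi : ∀ n, ∀ t ≥ (0:ℝ), IntervalIntegrable (g n) volume 0 t := by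
    intro n t ht
    refine (intervalIntegrable_const (c := B + B)).mono_fun' (hgm n t ht) ?_
    filter_upwards [hIoc ht] with s hs using hgB n s hs.1.le
  have hgshift : ∀ n, ∀ s ≥ (0:ℝ), g n (s + ω) = g (n + 1) s := by
    intro n s hs
    simp only [hg]
    rw [hFtper s hs]
    congr 3
    push_cast
    ring
  have hglim : Tendsto (fun n => ∫ s in (0:ℝ)..ω, g n s) atTop (𝓝 0) := by
    have := intervalIntegral.tendsto_integral_filter_of_dominated_convergence
      (μ := volume) (a := 0) (b := ω) (F := g) (f := fun _ => (0:ℝ)) (l := atTop)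
      (fun _ => B + B) (Eventually.of_forall fun n => hgm n ω hω.le)
      (Eventually.of_forall fun n => Eventually.of_forall fun s hs => by
        rw [Set.uIoc_of_le hω.le] at hs
        exact hgB n s hs.1.le)
      intervalIntegrable_const
      (Eventually.of_forall fun s hs => by
        rw [Set.uIoc_of_le hω.le] at hs
        exact tendsto_iff_norm_sub_tendsto_zero.1 (hFt s hs.1.le))
    simpa using this
  -- the contribution of the history before time `n * ω`
  set A : ℕ → E := fun n => ∫ s in (0:ℝ)..(n * ω), T (n * ω - s) (F s) with hA
  have hTA : ∀ n : ℕ, ∀ t ≥ (0:ℝ),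
      ∫ s in (0:ℝ)..(n * ω), T (t + n * ω - s) (F s) = T t (A n) := by
    intro n t ht
    rw [hA, ← (T t).intervalIntegral_comp_comm (hTFc0 _ (hnω n)).intervalIntegrable]
    refine intervalIntegral.integral_congr fun s hs => ?_
    rw [Set.uIcc_of_le (hnω n)] at hs
    rw [add_sub_assoc, hTsem t ht _ (sub_nonneg.2 hs.2)]
    rfl
  have hTA' : ∀ n : ℕ, ∀ t ≥ (0:ℝ),
      ∫ s in (0:ℝ)..(n * ω), T (t + s) (F (n * ω - s)) = T t (A n) := by
    intro n t ht
    rw [← hTA n t ht]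
    have h := intervalIntegral.integral_comp_sub_left (a := 0) (b := n * ω)
      (fun s => T (t + n * ω - s) (F s)) (n * ω)
    rw [sub_self, sub_zero] at h
    rw [← h]
    refine intervalIntegral.integral_congr fun s _ => ?_
    congr 2
    ring
  have hAlim : Tendsto A atTop (𝓝 (U 0)) :=
    (hU 0 le_rfl).congr fun n => by rw [hTA' n 0 le_rfl, hT0]; rfl
  have hUT : ∀ t ≥ (0:ℝ), U t = T t (U 0) := fun t ht =>
    tendsto_nhds_unique (hU t ht)
      ((((T t).continuous.tendsto _).comp hAlim).congr fun n => (hTA' n t ht).symm)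
  -- decomposition of the error
  have hdecomp : ∀ n : ℕ, ∀ t ≥ (0:ℝ),
      (∫ s in (0:ℝ)..(t + n * ω), T (t + n * ω - s) (F s)) -
        (U t + ∫ s in (0:ℝ)..t, T (t - s) (Ft s)) =
      T t (A n - U 0) + ∫ s in (0:ℝ)..t, T (t - s) (F (s + n * ω) - Ft s) := by
    intro n t ht
    have hi := (hTFc0 (t + n * ω) (add_nonneg ht (hnω n))).intervalIntegrable (μ := volume)
    have hmem : (n : ℝ) * ω ∈ Set.uIcc 0 (t + n * ω) := by
      rw [Set.uIcc_of_le (add_nonneg ht (hnω n))]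
      exact ⟨hnω n, by linarith⟩
    rw [← intervalIntegral.integral_add_adjacent_intervals
      (hi.mono_set (Set.uIcc_subset_uIcc_left hmem))
      (hi.mono_set (Set.uIcc_subset_uIcc_right hmem)), hTA n t ht, hUT t ht]
    have h := intervalIntegral.integral_comp_add_right (a := 0) (b := t)
      (fun s => T (t + n * ω - s) (F s)) (n * ω)
    rw [zero_add] at h
    simp only [add_sub_add_right_eq_sub] at h
    simp only [map_sub]
    rw [← h, intervalIntegral.integral_sub (hTFc n t ht).intervalIntegrable (hTFti t ht)]
    abel
  have hnormint : ∀ n : ℕ, ∀ t ≥ (0:ℝ),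
      ‖∫ s in (0:ℝ)..t, T (t - s) (F (s + n * ω) - Ft s)‖ ≤
        M * ∫ s in (0:ℝ)..t, Real.exp (-a * (t - s)) * g n s := by
    intro n t ht
    rw [← intervalIntegral.integral_const_mul]
    refine intervalIntegral.norm_integral_le_of_norm_le ht
      (Eventually.of_forall fun s hs => ?_)
      (((hgi n t ht).continuousOn_mul (by fun_prop)).const_mul M)
    rw [← mul_assoc]
    exact (T (t - s)).le_of_opNorm_le (hTnorm _ (sub_nonneg.2 hs.2)) _
  -- choice of `N`
  have hq : Real.exp (-a * ω) < 1 := by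
    rw [Real.exp_lt_one_iff]; nlinarith
  set c : ℝ := (1 - Real.exp (-a * ω))⁻¹ with hcdef
  have hc : 0 < c := inv_pos.2 (by linarith)
  set δ : ℝ := ε / (2 * M * (1 + c)) with hδdef
  have hδ : 0 < δ := by positivity
  obtain ⟨N₁, hN₁⟩ := eventually_atTop.1 (hglim.eventually (eventually_le_nhds hδ))
  obtain ⟨N₂, hN₂⟩ := Metric.tendsto_atTop.1 hAlim (ε / (2 * M)) (by positivity)
  refine ⟨max N₁ N₂, fun n hn t ht => ?_⟩
  rw [hdecomp n t ht]
  have hfirst : ‖T t (A n - U 0)‖ < ε / 2 := by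
    calc ‖T t (A n - U 0)‖ ≤ M * ‖A n - U 0‖ := (T t).le_of_opNorm_le (hTM t ht) _
      _ < M * (ε / (2 * M)) := by
        refine mul_lt_mul_of_pos_left ?_ hM
        rw [← dist_eq_norm]
        exact hN₂ n (le_of_max_le_right hn)
      _ = ε / 2 := by field_simp
  have hsecond : ‖∫ s in (0:ℝ)..t, T (t - s) (F (s + n * ω) - Ft s)‖ ≤ ε / 2 := by
    obtain ⟨k, hk⟩ := exists_nat_ge (t / ω)
    have htk : t ≤ (k + 1) * ω := by
      rw [div_le_iff₀ hω] at hk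
      linarith
    have hbound := integral_exp_mul_le_of_shift ha hω hδ.le (fun n s => norm_nonneg _) hgi hgshift
      k n (fun m hm => hN₁ m ((le_of_max_le_left hn).trans hm)) t ht htk
    have hle : δ * (1 + c * (1 - Real.exp (-a * t))) ≤ δ * (1 + c) := by
      refine mul_le_mul_of_nonneg_left ?_ hδ.le
      nlinarith [mul_pos hc (Real.exp_pos (-a * t))]
    calc _ ≤ M * ∫ s in (0:ℝ)..t, Real.exp (-a * (t - s)) * g n s := hnormint n t ht
      _ ≤ M * (δ * (1 + c)) := mul_le_mul_of_nonneg_left (hbound.trans hle) hM.le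
      _ = ε / 2 := by rw [hδdef]; field_simp
  linarith [norm_add_le (T t (A n - U 0)) (∫ s in (0:ℝ)..t, T (t - s) (F (s + n * ω) - Ft s))]

end StronglyContinuous

variable {Ω : Type*} [MeasurableSpace Ω] (P : Measure Ω) [IsProbabilityMeasure P]
  {H : Type*} [NormedAddCommGroup H] [InnerProductSpace ℝ H] [CompleteSpace H]
  [SecondCountableTopology H]

/-- let `F` be a square-mean `ω`-periodic limit process with limit
process `Ft`, and let `U(t)` be the limit in `L²(ℙ,H)` of `∫₀^{nω} T(t+s) F(nω − s) ds`.
With `V(t) = ∫₀^t T(t−s) F(s) ds` and `V*(t) = U(t) + ∫₀^t T(t−s) Ft(s) ds`, one has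
`E‖V(t+nω) − V*(t)‖² → 0` as `n → ∞` uniformly in `t ≥ 0`. -/
theorem integral_convolution_limit (ω : ℝ) (hω : 0 < ω)
    (T : ℝ → Lp H 2 P →L[ℝ] Lp H 2 P)
    (hT0 : T 0 = ContinuousLinearMap.id ℝ (Lp H 2 P))
    (hTsem : ∀ t ≥ (0:ℝ), ∀ r ≥ (0:ℝ), T (t + r) = (T t).comp (T r))
    (hTcont : ∀ x : Lp H 2 P, ContinuousOn (fun t => T t x) (Set.Ici 0))
    (M a : ℝ) (hM : 0 < M) (ha : 0 < a)
    (hTnorm : ∀ t ≥ (0:ℝ), ‖T t‖ ≤ M * Real.exp (-a * t))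
    (F Ft : ℝ → Lp H 2 P) (hF : IsPeriodicLimit P ω F Ft)
    (U : ℝ → Lp H 2 P)
    (hU : ∀ t ≥ (0:ℝ),
      Tendsto (fun n : ℕ => ∫ s in (0:ℝ)..(n * ω), T (t + s) (F (n * ω - s)))
        atTop (𝓝 (U t))) :
    ∀ ε > (0:ℝ), ∃ N : ℕ, ∀ n ≥ N, ∀ t ≥ (0:ℝ),
      ‖(∫ s in (0:ℝ)..(t + n * ω), T (t + n * ω - s) (F s)) -
        (U t + ∫ s in (0:ℝ)..t, T (t - s) (Ft s))‖ ^ 2 < ε := by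
  intro ε hε
  obtain ⟨hFc, ⟨K, _, hFK⟩, hFt⟩ := hF
  have hFlim : ∀ t ≥ (0:ℝ), Tendsto (fun n : ℕ => F (t + n * ω)) atTop (𝓝 (Ft t)) := by
    intro t ht
    rw [tendsto_iff_norm_sub_tendsto_zero]
    simpa using (hFt t ht).sqrt
  obtain ⟨N, hN⟩ := convolution_periodic_limit hω hT0 hTsem hTcont hM ha hTnorm hFc
    (fun t ht => Real.le_sqrt_of_sq_le (hFK t ht)) hFlim hU (Real.sqrt_pos.2 hε)
  exact ⟨N, fun n hn t ht => (Real.lt_sqrt (norm_nonneg _)).1 (hN n hn t ht)⟩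
end

section
/- Let F be a square-mean ω-periodic limit process with limit process F̃. Then lim_{n→∞} E‖∫₀^{t} T(t−s)(F(s+nω) − F̃(s)) ds‖² = 0 uniformly in t ≥ 0, where the integral is a Bochner integral in L²(ℙ,H). -/
open MeasureTheory Filter Topology

/-- An exponentially weighted integral is controlled by the integrals over single periods. -/
theorem integral_exp_mul_le_of_period_le {a ω δ : ℝ} (ha : 0 < a) (hω : 0 < ω) {f : ℝ → ℝ}
    (hf0 : ∀ s ≥ 0, 0 ≤ f s) (hfi : ∀ b c, 0 ≤ b → 0 ≤ c → IntervalIntegrable f volume b c)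
    (hδ : ∀ k : ℕ, ∫ s in (0:ℝ)..ω, f (s + k * ω) ≤ δ) {t : ℝ} (ht : 0 ≤ t) :
    ∫ s in (0:ℝ)..t, Real.exp (-a * (t - s)) * f s
      ≤ δ * (Real.exp (a * ω) / (Real.exp (a * ω) - 1) * Real.exp (a * ω)) := by
  set Q := Real.exp (a * ω) with hQ
  have hQ1 : 1 < Q := Real.one_lt_exp_iff.2 (mul_pos ha hω)
  have hwi : ∀ b c, 0 ≤ b → 0 ≤ c →
      IntervalIntegrable (fun s => Real.exp (a * s) * f s) volume b c := fun b c hb hc =>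
    (hfi b c hb hc).continuousOn_mul (by fun_prop)
  have hkω : ∀ k : ℕ, 0 ≤ k * ω := fun k => by positivity
  have hδ0 : 0 ≤ δ := le_trans (intervalIntegral.integral_nonneg hω.le fun s hs =>
    hf0 _ (add_nonneg hs.1 (hkω 0))) (hδ 0)
  have hperiods : ∀ k : ℕ, ∫ s in (0:ℝ)..(k * ω), Real.exp (a * s) * f s
      ≤ δ * (Q / (Q - 1)) * Q ^ k := by
    intro k
    induction k with
    | zero =>
      have : 0 ≤ Q / (Q - 1) := div_nonneg (by linarith) (by linarith)
      simp only [Nat.cast_zero, zero_mul, intervalIntegral.integral_same]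
      positivity
    | succ k ih =>
      have hle : (k : ℝ) * ω ≤ (k + 1 : ℕ) * ω := by
        push_cast; nlinarith
      have hlast : ∫ s in (k * ω)..((k + 1 : ℕ) * ω), Real.exp (a * s) * f s
          ≤ Q ^ (k + 1) * δ := by
        calc _ ≤ ∫ s in (k * ω)..((k + 1 : ℕ) * ω), Q ^ (k + 1) * f s := by
              refine intervalIntegral.integral_mono_on hle (hwi _ _ (hkω _) (hkω _))
                ((hfi _ _ (hkω _) (hkω _)).const_mul _) fun s hs => ?_
              refine mul_le_mul_of_nonneg_right ?_ (hf0 s ((hkω k).trans hs.1))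
              rw [hQ, ← Real.exp_nat_mul]
              refine Real.exp_le_exp.2 ?_
              nlinarith [hs.2]
          _ = Q ^ (k + 1) * ∫ s in (0:ℝ)..ω, f (s + k * ω) := by
              rw [intervalIntegral.integral_const_mul,
                intervalIntegral.integral_comp_add_right (f := f)]
              congr 2 <;> push_cast <;> ring
          _ ≤ _ := mul_le_mul_of_nonneg_left (hδ k) (by positivity)
      rw [← intervalIntegral.integral_add_adjacent_intervals
        (hwi 0 (k * ω) le_rfl (hkω k)) (hwi _ _ (hkω k) (hkω (k + 1)))]
      refine (add_le_add ih hlast).trans_eq ?_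
      have : Q - 1 ≠ 0 := by linarith
      field_simp
      ring
  set k := ⌊t / ω⌋₊ + 1
  have htk : t ≤ k * ω := by
    rw [← div_le_iff₀ hω]
    exact_mod_cast (Nat.lt_floor_add_one (t / ω)).le
  have hkt : k * ω ≤ t + ω := by
    have := mul_le_mul_of_nonneg_right (Nat.floor_le (div_nonneg ht hω.le)) hω.le
    rw [div_mul_cancel₀ _ hω.ne'] at this
    simp only [k, Nat.cast_add, Nat.cast_one]
    linarith
  have hC : 0 ≤ δ * (Q / (Q - 1)) := mul_nonneg hδ0 (div_nonneg (by linarith) (by linarith))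
  calc ∫ s in (0:ℝ)..t, Real.exp (-a * (t - s)) * f s
      = Real.exp (-a * t) * ∫ s in (0:ℝ)..t, Real.exp (a * s) * f s := by
        rw [← intervalIntegral.integral_const_mul]
        congr 1 with s
        rw [← mul_assoc, ← Real.exp_add]
        ring_nf
    _ ≤ Real.exp (-a * t) * ∫ s in (0:ℝ)..(k * ω), Real.exp (a * s) * f s := by
        refine mul_le_mul_of_nonneg_left ?_ (Real.exp_pos _).le
        rw [← intervalIntegral.integral_add_adjacent_intervals
          (hwi 0 t le_rfl ht) (hwi t _ ht (hkω k))]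
        exact le_add_of_nonneg_right (intervalIntegral.integral_nonneg htk fun s hs =>
          mul_nonneg (Real.exp_pos _).le (hf0 s (ht.trans hs.1)))
    _ ≤ Real.exp (-a * t) * (δ * (Q / (Q - 1)) * Q ^ k) :=
        mul_le_mul_of_nonneg_left (hperiods k) (Real.exp_pos _).le
    _ = δ * (Q / (Q - 1)) * Real.exp (a * (k * ω - t)) := by
        rw [hQ, ← Real.exp_nat_mul, mul_left_comm, ← Real.exp_add]
        ring_nf
    _ ≤ δ * (Q / (Q - 1)) * Q :=
        mul_le_mul_of_nonneg_left (Real.exp_le_exp.2 (by nlinarith)) hC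
    _ = _ := by ring

/-- The pointwise limit along integer translates is periodic. -/
theorem eq_add_mul_of_tendsto_translates {E : Type*} [TopologicalSpace E] [T2Space E]
    {ω : ℝ} (hω : 0 < ω) {F Ft : ℝ → E}
    (h : ∀ s ≥ 0, Tendsto (fun n : ℕ => F (s + n * ω)) atTop (𝓝 (Ft s)))
    {s : ℝ} (hs : 0 ≤ s) (k : ℕ) : Ft (s + k * ω) = Ft s := by
  refine tendsto_nhds_unique (h (s + k * ω) (by positivity)) ?_
  refine ((h s hs).comp (tendsto_add_atTop_nat k)).congr fun n => ?_
  simp only [Function.comp_apply]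
  congr 1
  push_cast
  ring

/-- Translates of a bounded continuous function that converge pointwise on the half-line have
convolutions with an exponentially stable kernel converging uniformly on the half-line. -/
theorem exists_forall_norm_convolution_lt {E : Type*} [NormedAddCommGroup E] [NormedSpace ℝ E]
    {ω M a B : ℝ} (hω : 0 < ω) (hM : 0 < M) (ha : 0 < a) {T : ℝ → E →L[ℝ] E}
    (hT : ∀ t ≥ 0, ‖T t‖ ≤ M * Real.exp (-a * t)) {F Ft : ℝ → E}
    (hFc : ContinuousOn F (Set.Ici 0)) (hFb : ∀ s ≥ 0, ‖F s‖ ≤ B)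
    (h : ∀ s ≥ 0, Tendsto (fun n : ℕ => F (s + n * ω)) atTop (𝓝 (Ft s)))
    {ε : ℝ} (hε : 0 < ε) :
    ∃ N : ℕ, ∀ n ≥ N, ∀ t ≥ 0,
      ‖∫ s in (0:ℝ)..t, T (t - s) (F (s + n * ω) - Ft s)‖ < ε := by
  have hFtb : ∀ s ≥ 0, ‖Ft s‖ ≤ B := fun s hs =>
    le_of_tendsto (h s hs).norm (Eventually.of_forall fun n => hFb _ (by positivity))
  have hFn : ∀ n : ℕ, AEStronglyMeasurable (fun s => F (s + n * ω))
      (volume.restrict (Set.Ici (0:ℝ))) := fun n =>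
    (hFc.comp (by fun_prop) fun s (hs : 0 ≤ s) => by
      change 0 ≤ s + n * ω
      positivity).aestronglyMeasurable measurableSet_Ici
  have hFtm : AEStronglyMeasurable Ft (volume.restrict (Set.Ici (0:ℝ))) :=
    aestronglyMeasurable_of_tendsto_ae atTop hFn
      ((ae_restrict_iff' measurableSet_Ici).2 (Eventually.of_forall h))
  set g : ℕ → ℝ → ℝ := fun n s => ‖F (s + n * ω) - Ft s‖ with hg
  have hgm : ∀ n, AEStronglyMeasurable (g n) (volume.restrict (Set.Ici (0:ℝ))) := fun n =>
    ((hFn n).sub hFtm).norm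
  have hgb : ∀ n, ∀ s ≥ 0, ‖g n s‖ ≤ B + B := fun n s hs => by
    rw [hg, norm_norm]
    exact (norm_sub_le _ _).trans (add_le_add (hFb _ (by positivity)) (hFtb s hs))
  have hsub : ∀ b c : ℝ, 0 ≤ b → 0 ≤ c → Set.uIoc b c ⊆ Set.Ici 0 := fun b c hb hc s hs =>
    (le_min hb hc).trans hs.1.le
  have hgi : ∀ n b c, 0 ≤ b → 0 ≤ c → IntervalIntegrable (g n) volume b c :=
    fun n b c hb hc => (intervalIntegrable_const (c := B + B)).mono_fun'
      ((hgm n).mono_measure (Measure.restrict_mono (hsub b c hb hc) le_rfl))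
      ((ae_restrict_iff' measurableSet_uIoc).2
        (Eventually.of_forall fun s hs => hgb n s (hsub b c hb hc hs)))
  have hlim : Tendsto (fun n => ∫ s in (0:ℝ)..ω, g n s) atTop (𝓝 0) := by
    have := intervalIntegral.tendsto_integral_filter_of_dominated_convergence
      (μ := volume) (a := 0) (b := ω) (F := g) (f := fun _ => (0:ℝ)) (l := atTop)
      (fun _ => B + B)
      (Eventually.of_forall fun n => (hgm n).mono_measure
        (Measure.restrict_mono (hsub 0 ω le_rfl hω.le) le_rfl))
      (Eventually.of_forall fun n => Eventually.of_forall fun s hs =>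
        hgb n s (hsub 0 ω le_rfl hω.le hs))
      intervalIntegrable_const
      (Eventually.of_forall fun s hs =>
        tendsto_iff_norm_sub_tendsto_zero.1 (h s (hsub 0 ω le_rfl hω.le hs)))
    simpa using this
  set C := Real.exp (a * ω) / (Real.exp (a * ω) - 1) * Real.exp (a * ω)
  have hC : 0 < C := mul_pos (div_pos (Real.exp_pos _)
    (sub_pos.2 (Real.one_lt_exp_iff.2 (mul_pos ha hω)))) (Real.exp_pos _)
  obtain ⟨N, hN⟩ := eventually_atTop.1
    (hlim.eventually_lt_const (show 0 < ε / (2 * (M * C)) by positivity))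
  refine ⟨N, fun n hn t ht => ?_⟩
  have hperiod : ∀ k : ℕ, ∫ s in (0:ℝ)..ω, g n (s + k * ω) ≤ ε / (2 * (M * C)) := fun k => by
    refine le_of_eq_of_le (intervalIntegral.integral_congr fun s hs => ?_)
      (hN (n + k) (by omega)).le
    rw [Set.uIcc_of_le hω.le] at hs
    simp only [hg, eq_add_mul_of_tendsto_translates hω h hs.1 k]
    congr 3
    push_cast
    ring
  calc _ ≤ ∫ s in (0:ℝ)..t, M * (Real.exp (-a * (t - s)) * g n s) := by
        refine intervalIntegral.norm_integral_le_of_norm_le ht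
          (Eventually.of_forall fun s hs => ?_)
          (((hgi n 0 t le_rfl ht).continuousOn_mul (by fun_prop)).const_mul M)
        rw [← mul_assoc]
        exact (T (t - s)).le_of_opNorm_le (hT _ (sub_nonneg.2 hs.2)) _
    _ = M * ∫ s in (0:ℝ)..t, Real.exp (-a * (t - s)) * g n s :=
        intervalIntegral.integral_const_mul _ _
    _ ≤ M * (ε / (2 * (M * C)) * C) := mul_le_mul_of_nonneg_left
        (integral_exp_mul_le_of_period_le ha hω (fun s _ => norm_nonneg _) (hgi n) hperiod ht)
        hM.le
    _ = ε / 2 := by field_simp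
    _ < ε := half_lt_self hε

variable {Ω : Type*} [MeasurableSpace Ω] (P : Measure Ω) [IsProbabilityMeasure P]
  {H : Type*} [NormedAddCommGroup H] [InnerProductSpace ℝ H] [CompleteSpace H]
  [SecondCountableTopology H]

/-- if `F` is a square-mean `ω`-periodic limit process with limit process
`Ft`, then `E‖∫₀^t T(t−s)(F(s+nω) − Ft(s)) ds‖² → 0` as `n → ∞` uniformly in `t ≥ 0`,
the integral being a Bochner integral in `L²(ℙ,H)`. -/
theorem integral_difference_limit (ω : ℝ) (hω : 0 < ω)
    (T : ℝ → Lp H 2 P →L[ℝ] Lp H 2 P)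
    (hT0 : T 0 = ContinuousLinearMap.id ℝ (Lp H 2 P))
    (hTsem : ∀ t ≥ (0:ℝ), ∀ r ≥ (0:ℝ), T (t + r) = (T t).comp (T r))
    (hTcont : ∀ x : Lp H 2 P, ContinuousOn (fun t => T t x) (Set.Ici 0))
    (M a : ℝ) (hM : 0 < M) (ha : 0 < a)
    (hTnorm : ∀ t ≥ (0:ℝ), ‖T t‖ ≤ M * Real.exp (-a * t))
    (F Ft : ℝ → Lp H 2 P) (hF : IsPeriodicLimit P ω F Ft) :
    ∀ ε > (0:ℝ), ∃ N : ℕ, ∀ n ≥ N, ∀ t ≥ (0:ℝ),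
      ‖∫ s in (0:ℝ)..t, T (t - s) (F (s + n * ω) - Ft s)‖ ^ 2 < ε := by
  intro ε hε
  obtain ⟨hFc, ⟨K, hK, hFb⟩, hlim⟩ := hF
  have h : ∀ s ≥ (0:ℝ), Tendsto (fun n : ℕ => F (s + n * ω)) atTop (𝓝 (Ft s)) := fun s hs => by
    rw [tendsto_iff_norm_sub_tendsto_zero]
    simpa [Real.sqrt_sq] using (hlim s hs).sqrt
  obtain ⟨N, hN⟩ := exists_forall_norm_convolution_lt hω hM ha hTnorm hFc
    (fun s hs => Real.le_sqrt_of_sq_le (hFb s hs)) h (Real.sqrt_pos.2 hε)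
  exact ⟨N, fun n hn t ht => (Real.lt_sqrt (norm_nonneg _)).1 (hN n hn t ht)⟩
end

section
/- Let (k_n)_{n≥1} be a sequence in (0,1) with k_n > k_{n+1} for all n and k_n → 0 as n → ∞. Define a : [0,∞) → ℝ by a(t) = max(0, 1 − |t − 1|) for t ∈ [0,2], and a(t) = max(0, 1 − |t − (2n+1)|/k_n) for t ∈ [2n, 2n+2] with n ≥ 1. Define b : [0,∞) → ℝ by b(t) = 1 if t = 2n − 1 for some positive integer n, and b(t) = 0 otherwise. Then for every t ≥ 0, a(t + 2m) → b(t) as m → ∞ (m ∈ ℕ); that is, a is a 2-periodic limit function with limit function b. -/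
open MeasureTheory Filter Topology

/-- with `(k_n)_{n≥1} ⊆ (0,1)` strictly decreasing to `0`, the piecewise
linear function `a` given by `a(t) = max 0 (1 − |t−1|)` on `[0,2]` and
`a(t) = max 0 (1 − |t − (2n+1)|/k_n)` on `[2n, 2n+2]` for `n ≥ 1` is a 2-periodic limit
function with limit function `b`, where `b(t) = 1` if `t = 2n−1` for some positive
integer `n` and `b(t) = 0` otherwise: for every `t ≥ 0`, `a(t + 2m) → b(t)` as `m → ∞`. -/
theorem periodic_limit_example (k : ℕ → ℝ)
    (hk : ∀ n : ℕ, 1 ≤ n → k n ∈ Set.Ioo (0:ℝ) 1)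
    (hkanti : ∀ n : ℕ, 1 ≤ n → k (n + 1) < k n)
    (hk0 : Tendsto k atTop (𝓝 0))
    (a b : ℝ → ℝ)
    (ha0 : ∀ t ∈ Set.Icc (0:ℝ) 2, a t = max 0 (1 - |t - 1|))
    (han : ∀ n : ℕ, 1 ≤ n → ∀ t ∈ Set.Icc (2 * (n:ℝ)) (2 * (n:ℝ) + 2),
      a t = max 0 (1 - |t - (2 * (n:ℝ) + 1)| / k n))
    (hb1 : ∀ n : ℕ, 1 ≤ n → b (2 * (n:ℝ) - 1) = 1)
    (hb2 : ∀ t : ℝ, (¬ ∃ n : ℕ, 1 ≤ n ∧ t = 2 * (n:ℝ) - 1) → b t = 0) :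
    ∀ t ≥ (0:ℝ), Tendsto (fun m : ℕ => a (t + 2 * m)) atTop (𝓝 (b t)) := by
  intro t ht
  obtain ⟨j, hj1, hj2⟩ : ∃ j : ℕ, 2 * (j : ℝ) ≤ t ∧ t < 2 * (j : ℝ) + 2 := by
    have hle := Nat.floor_le (show 0 ≤ t / 2 by linarith)
    have hlt := Nat.lt_floor_add_one (t / 2)
    exact ⟨⌊t / 2⌋₊, by linarith, by linarith⟩
  have ha : ∀ m : ℕ, 1 ≤ m →
      a (t + 2 * m) = max 0 (1 - |t - (2 * (j : ℝ) + 1)| / k (j + m)) := by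
    intro m hm
    rw [han (j + m) (by omega) (t + 2 * m)
      ⟨by push_cast; linarith, by push_cast; linarith⟩]
    congr 4
    push_cast
    ring
  by_cases htj : t = 2 * (j : ℝ) + 1
  · have hb : b t = 1 := by
      rw [← hb1 (j + 1) (by omega), htj]
      congr 1
      push_cast
      ring
    rw [hb]
    refine tendsto_const_nhds.congr' ?_
    filter_upwards [eventually_ge_atTop 1] with m hm
    rw [ha m hm]
    simp [htj]
  · have hb : b t = 0 := by
      refine hb2 t ?_
      rintro ⟨n, -, rfl⟩
      have hlt : n < j + 2 := by
        have : (n : ℝ) < (j : ℝ) + 2 := by linarith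
        exact_mod_cast this
      have hgt : j < n := by
        have : (j : ℝ) < n := by linarith
        exact_mod_cast this
      obtain rfl : n = j + 1 := by omega
      exact htj (by push_cast; ring)
    rw [hb]
    have hpos : 0 < |t - (2 * (j : ℝ) + 1)| := abs_pos.mpr (sub_ne_zero.mpr htj)
    have hkj : Tendsto (fun m => k (j + m)) atTop (𝓝 0) :=
      hk0.comp (tendsto_atTop_mono (fun m => Nat.le_add_left m j) tendsto_id)
    refine tendsto_const_nhds.congr' ?_
    filter_upwards [eventually_ge_atTop 1, hkj.eventually_lt_const hpos] with m hm hkm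
    have hone : 1 ≤ |t - (2 * (j : ℝ) + 1)| / k (j + m) :=
      (one_le_div (hk (j + m) (by omega)).1).mpr hkm.le
    rw [ha m hm, max_eq_left (by linarith)]
end
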